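/- Let d ≥ 1 and 2 ≤ p < ∞. There is a constant C (depending only on d and p) such that for all n ∈ ℕ and all 1 ≤ m ≤ |Q_n|, the best m-term trigonometric approximation of the step hyperbolic cross projection satisfies σ_m(S_{Q_n} : L_p(𝕋^d) → L_∞(𝕋^d)) ≤ C (2^n/m)^{1/p} n^{(d−1)(1−1/p) + 1/p}. -/

import Mathlib

open MeasureTheory Real
open scoped ENNReal ComplexConjugate Classical

noncomputable section

instance : Fact (0 < 2 * π) := ⟨by positivity⟩

/-- The `d`-dimensional torus `[0, 2π]^d`. -/
abbrev Torus (d : ℕ) := Fin d → AddCircle (2 * π)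

/-- The multivariate trigonometric character `x ↦ e^{i k · x}`. -/
def trigChar {d : ℕ} (k : Fin d → ℤ) : C(Torus d, ℂ) :=
  ⟨fun x => ∏ j, fourier (k j) (x j),
    continuous_finset_prod _ fun j _ => (map_continuous (fourier (k j))).comp (continuous_apply j)⟩

/-- The Fourier coefficient `f̂(k) = (2π)^{-d} ∫ f(x) e^{-i k·x} dx`. -/
def fCoeff {d : ℕ} (f : Torus d → ℂ) (k : Fin d → ℤ) : ℂ :=
  ((2 * π) ^ d)⁻¹ • ∫ x : Torus d, conj (trigChar k x) * f x

/-- A continuous function on the torus, considered as an element of `L_∞`. -/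
def toLinfty {d : ℕ} (g : C(Torus d, ℂ)) : Lp ℂ ∞ (volume : Measure (Torus d)) :=
  ContinuousMap.toLp ∞ (volume : Measure (Torus d)) ℂ g

/-- The Fourier projection `S_E f = ∑_{k ∈ E} f̂(k) e^{i k·x}`, as an operator from
`L_q(𝕋^d)` to `L_∞(𝕋^d)`. -/
def SE (d : ℕ) (q : ℝ≥0∞) (E : Finset (Fin d → ℤ))
    (f : Lp ℂ q (volume : Measure (Torus d))) : Lp ℂ ∞ (volume : Measure (Torus d)) :=
  toLinfty (∑ k ∈ E, fCoeff (f : Torus d → ℂ) k • trigChar k)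

/-- The dyadic block `ρ(s) = {k : ⌊2^{s_j - 1}⌋ ≤ |k_j| < 2^{s_j}, j = 1,…,d}`. -/
def inRho {d : ℕ} (s : Fin d → ℕ) (k : Fin d → ℤ) : Prop :=
  ∀ j, (2 ^ (s j) / 2 : ℤ) ≤ |k j| ∧ |k j| < 2 ^ (s j)

/-- The step hyperbolic cross `Q_n = ⋃_{‖s‖₁ ≤ n} ρ(s)` as a finite set of frequencies. -/
def hypCross (d n : ℕ) : Finset (Fin d → ℤ) :=
  (Finset.Icc (fun _ => -(2 ^ n : ℤ)) fun _ => (2 ^ n : ℤ)).filter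
    fun k => ∃ s : Fin d → ℕ, (∑ j, s j) ≤ n ∧ inRho s k

/-- The set `Y_n` of trigonometric polynomials with at most `n` frequencies,
as a subset of `L_∞(𝕋^d)`. -/
def sparseTrig (d n : ℕ) : Set (Lp ℂ ∞ (volume : Measure (Torus d))) :=
  {g | ∃ Λ : Finset (Fin d → ℤ), Λ.card ≤ n ∧ ∃ c : (Fin d → ℤ) → ℂ,
    g = toLinfty (∑ k ∈ Λ, c k • trigChar k)}

/-- The `m`-th error of best approximation of a map `T : X → Y` with respect to
the sets `(Yn)`: `σ_m(T) = sup_{‖x‖ ≤ 1} inf_{y ∈ Y_{m-1}} ‖T x - y‖`. -/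
noncomputable def sigmaA {X Y : Type*} [Norm X] [NormedAddCommGroup Y]
    (T : X → Y) (Yn : ℕ → Set Y) (m : ℕ) : ℝ :=
  ⨆ x : {x : X // ‖x‖ ≤ 1}, ⨅ y : Yn (m - 1), ‖T x.1 - (y : Y)‖

section

variable {d : ℕ}

lemma trigChar_apply (k : Fin d → ℤ) (x : Torus d) :
    trigChar k x = ∏ j, fourier (k j) (x j) := rfl

lemma norm_trigChar (k : Fin d → ℤ) (x : Torus d) : ‖trigChar k x‖ = 1 := by
  rw [trigChar_apply, norm_prod]
  exact Finset.prod_eq_one fun j _ => by rw [fourier_apply, Circle.norm_coe]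

lemma trigChar_zero (x : Torus d) : trigChar (0 : Fin d → ℤ) x = 1 := by
  simp [trigChar_apply]

lemma trigChar_add (k l : Fin d → ℤ) (x : Torus d) :
    trigChar (k + l) x = trigChar k x * trigChar l x := by
  simp only [trigChar_apply, Pi.add_apply, fourier_add, Finset.prod_mul_distrib]

lemma trigChar_neg (k : Fin d → ℤ) (x : Torus d) :
    trigChar (-k) x = conj (trigChar k x) := by
  simp only [trigChar_apply, Pi.neg_apply, fourier_neg, map_prod]

lemma trigChar_add_point (k : Fin d → ℤ) (x y : Torus d) :
    trigChar k (x + y) = trigChar k x * trigChar k y := by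
  simp only [trigChar_apply, ← Finset.prod_mul_distrib, Pi.add_apply]
  refine Finset.prod_congr rfl fun j _ => ?_
  simp [fourier_apply, smul_add, AddCircle.toCircle_add]

lemma trigChar_neg_point (k : Fin d → ℤ) (x : Torus d) :
    trigChar k (-x) = conj (trigChar k x) := by
  rw [← trigChar_neg]
  simp [trigChar_apply, fourier_apply]

lemma trigChar_two_nsmul_point (k : Fin d → ℤ) (x : Torus d) :
    trigChar k (2 • x) = trigChar (k + k) x := by
  rw [two_nsmul, trigChar_add_point, trigChar_add]

/-- The total mass of the torus. -/
def torusVol (d : ℕ) : ℝ := (2 * π) ^ d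

lemma torusVol_pos : 0 < torusVol d := by unfold torusVol; positivity

lemma torus_volume_univ : (volume : Measure (Torus d)) Set.univ = ENNReal.ofReal (torusVol d) := by
  have : (volume : Measure (Torus d)) Set.univ = ∏ _j : Fin d, ENNReal.ofReal (2 * π) := by
    rw [volume_pi, Measure.pi_univ]
    simp [AddCircle.measure_univ]
  rw [this, torusVol, Finset.prod_const, Finset.card_univ, Fintype.card_fin,
    ENNReal.ofReal_pow (by positivity)]

lemma torus_volume_real_univ : (volume : Measure (Torus d)).real Set.univ = torusVol d := by
  rw [Measure.real, torus_volume_univ, ENNReal.toReal_ofReal torusVol_pos.le]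

lemma integral_trigChar (k : Fin d → ℤ) :
    ∫ x : Torus d, trigChar k x = if k = 0 then (torusVol d : ℂ) else 0 := by
  split_ifs with h
  · subst h
    simp [trigChar_zero, torus_volume_real_univ]
  · obtain ⟨j, hj⟩ : ∃ j, k j ≠ 0 := by
      by_contra hc
      push Not at hc
      exact h (funext hc)
    set y : Torus d := Pi.single j ((2 * π / 2 / (k j : ℝ) : ℝ) : AddCircle (2 * π)) with hy
    have hyk : trigChar k y = -1 := by
      rw [trigChar_apply, Finset.prod_eq_single j]
      · have := fourier_add_half_inv_index (T := 2 * π) hj (by positivity) 0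
        simpa [hy] using this
      · intro i _ hi
        simp [hy, Pi.single_eq_of_ne hi]
      · simp
    have h1 : ∫ x : Torus d, trigChar k (x + y) = ∫ x : Torus d, trigChar k x :=
      integral_add_right_eq_self (fun x => trigChar k x) y
    simp only [trigChar_add_point, hyk, mul_neg, mul_one, integral_neg] at h1
    have : (2 : ℂ) * ∫ x : Torus d, trigChar k x = 0 := by linear_combination -h1
    simpa using this

lemma measurePreserving_neg_torus :
    MeasurePreserving (fun x : Torus d => -x) volume volume :=
  AddMonoidHom.measurePreserving (f := negAddMonoidHom (α := Torus d)) continuous_neg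
    neg_surjective rfl

lemma torus_two_nsmul_surjective : Function.Surjective (fun x : Torus d => 2 • x) := by
  intro y
  have : ∀ j, ∃ z : AddCircle (2 * π), 2 • z = y j := by
    intro j
    induction y j using QuotientAddGroup.induction_on with
    | H z =>
      refine ⟨((z / 2 : ℝ) : AddCircle (2 * π)), ?_⟩
      rw [← AddCircle.coe_nsmul]
      congr 1
      simp; ring
  choose z hz using this
  exact ⟨z, funext hz⟩

lemma measurePreserving_two_nsmul_torus :
    MeasurePreserving (fun x : Torus d => 2 • x) volume volume :=
  AddMonoidHom.measurePreserving (f := nsmulAddMonoidHom (α := Torus d) 2)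
    (continuous_const_smul (2 : ℕ)) torus_two_nsmul_surjective rfl

/-- The trigonometric polynomial with frequencies in `E` and coefficients `c`. -/
def trigPoly (E : Finset (Fin d → ℤ)) (c : (Fin d → ℤ) → ℂ) (x : Torus d) : ℂ :=
  ∑ k ∈ E, c k * trigChar k x

lemma continuous_trigPoly (E : Finset (Fin d → ℤ)) (c : (Fin d → ℤ) → ℂ) :
    Continuous (trigPoly E c) := by
  unfold trigPoly
  fun_prop

lemma trigPoly_add (E : Finset (Fin d → ℤ)) (c c' : (Fin d → ℤ) → ℂ) (x : Torus d) :
    trigPoly E (fun k => c k + c' k) x = trigPoly E c x + trigPoly E c' x := by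
  simp [trigPoly, add_mul, Finset.sum_add_distrib]

lemma norm_trigPoly_le (E : Finset (Fin d → ℤ)) (c : (Fin d → ℤ) → ℂ) (x : Torus d) :
    ‖trigPoly E c x‖ ≤ ∑ k ∈ E, ‖c k‖ := by
  refine (norm_sum_le _ _).trans (Finset.sum_le_sum fun k _ => ?_)
  rw [norm_mul, norm_trigChar, mul_one]

lemma integrable_of_continuous_torus {F : Type*} [NormedAddCommGroup F] {g : Torus d → F}
    (hg : Continuous g) : Integrable g :=
  hg.integrable_of_hasCompactSupport (HasCompactSupport.of_compactSpace g)


lemma integrable_conj_trigChar_mul {f : Torus d → ℂ} (hf : Integrable f) (k : Fin d → ℤ) :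
    Integrable (fun x => conj (trigChar k x) * f x) := by
  refine hf.bdd_mul (c := 1) ?_ ?_
  · exact (Continuous.aestronglyMeasurable (by fun_prop))
  · exact Filter.Eventually.of_forall fun x => by simp [norm_trigChar]

lemma integral_conj_trigChar_mul (f : Torus d → ℂ) (k : Fin d → ℤ) :
    ∫ x : Torus d, conj (trigChar k x) * f x = torusVol d * fCoeff f k := by
  have : (torusVol d : ℂ) ≠ 0 := by exact_mod_cast torusVol_pos.ne'
  rw [fCoeff, ← torusVol, Complex.real_smul, Complex.ofReal_inv, mul_inv_cancel_left₀ this]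

lemma fCoeff_add {f g : Torus d → ℂ} (hf : Integrable f) (hg : Integrable g) (k : Fin d → ℤ) :
    fCoeff (fun x => f x + g x) k = fCoeff f k + fCoeff g k := by
  simp only [fCoeff, mul_add]
  rw [integral_add (integrable_conj_trigChar_mul hf k) (integrable_conj_trigChar_mul hg k),
    smul_add]

lemma integral_conj_trigPoly_mul {f : Torus d → ℂ} (hf : Integrable f)
    (E : Finset (Fin d → ℤ)) (c : (Fin d → ℤ) → ℂ) :
    ∫ x : Torus d, conj (trigPoly E c x) * f x =
      torusVol d * ∑ k ∈ E, conj (c k) * fCoeff f k := by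
  simp only [trigPoly, map_sum, map_mul, Finset.sum_mul, mul_assoc]
  rw [integral_finsetSum _ fun k _ => (integrable_conj_trigChar_mul hf k).const_mul _,
    Finset.mul_sum]
  refine Finset.sum_congr rfl fun k _ => ?_
  rw [integral_const_mul, integral_conj_trigChar_mul]
  ring

lemma fCoeff_trigPoly (E : Finset (Fin d → ℤ)) (c : (Fin d → ℤ) → ℂ) (k : Fin d → ℤ) :
    fCoeff (trigPoly E c) k = if k ∈ E then c k else 0 := by
  have hV : (torusVol d : ℂ) ≠ 0 := by exact_mod_cast torusVol_pos.ne'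
  apply mul_left_cancel₀ hV
  rw [← integral_conj_trigChar_mul]
  have h1 : ∀ x, conj (trigChar k x) * trigPoly E c x = ∑ l ∈ E, c l * trigChar (l - k) x := by
    intro x
    rw [trigPoly, Finset.mul_sum]
    refine Finset.sum_congr rfl fun l _ => ?_
    rw [sub_eq_add_neg, trigChar_add, trigChar_neg]
    ring
  simp only [h1]
  rw [integral_finsetSum _ fun l _ => (integrable_of_continuous_torus (by fun_prop))]
  simp only [integral_const_mul, integral_trigChar, sub_eq_zero, mul_ite, mul_zero]
  rw [Finset.sum_ite_eq']
  split_ifs <;> ring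

lemma conj_mul_self_eq (z : ℂ) : conj z * z = ((‖z‖ ^ 2 : ℝ) : ℂ) := by
  rw [mul_comm, Complex.mul_conj, Complex.normSq_eq_norm_sq]

lemma integral_norm_sq_trigPoly (E : Finset (Fin d → ℤ)) (c : (Fin d → ℤ) → ℂ) :
    ∫ x : Torus d, ‖trigPoly E c x‖ ^ 2 = torusVol d * ∑ k ∈ E, ‖c k‖ ^ 2 := by
  have h := integral_conj_trigPoly_mul
    (integrable_of_continuous_torus (continuous_trigPoly E c)) E c
  simp only [conj_mul_self_eq] at h
  rw [integral_complex_ofReal] at h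
  apply Complex.ofReal_injective
  refine h.trans ?_
  push_cast
  congr 1
  refine Finset.sum_congr rfl fun k hk => ?_
  rw [fCoeff_trigPoly, if_pos hk, conj_mul_self_eq]
  push_cast; rfl

/-- Bessel's inequality on the torus. -/
lemma bessel_torus {f : Torus d → ℂ} (hf : MemLp f 2) (E : Finset (Fin d → ℤ)) :
    torusVol d * ∑ k ∈ E, ‖fCoeff f k‖ ^ 2 ≤ ∫ x : Torus d, ‖f x‖ ^ 2 := by
  set P := trigPoly E (fCoeff f) with hP
  have hPc : Continuous P := continuous_trigPoly _ _
  have hfi : Integrable f := hf.integrable (by norm_num)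
  have h1 : Integrable (fun x => ‖f x‖ ^ 2) := hf.integrable_norm_pow (by norm_num)
  have h2 : Integrable (fun x => ‖P x‖ ^ 2) := integrable_of_continuous_torus (by fun_prop)
  have h3 : Integrable (fun x => conj (P x) * f x) := by
    obtain ⟨B, hB⟩ := (isCompact_range hPc).isBounded.exists_norm_le
    refine hfi.bdd_mul (c := B) (Continuous.aestronglyMeasurable (by fun_prop)) ?_
    exact Filter.Eventually.of_forall fun x => by simpa using hB (P x) ⟨x, rfl⟩
  have h4 : ∀ x, ‖f x - P x‖ ^ 2 = ‖f x‖ ^ 2 + ‖P x‖ ^ 2 - 2 * (conj (P x) * f x).re := by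
    intro x
    simp only [← Complex.normSq_eq_norm_sq, Complex.normSq_sub]
    rw [mul_comm (f x)]
  have h5 : 0 ≤ ∫ x, ‖f x - P x‖ ^ 2 := integral_nonneg fun x => by positivity
  have h3' : Integrable (fun x => 2 * (conj (P x) * f x).re) := h3.re.const_mul 2
  simp only [h4] at h5
  have h12 : Integrable (fun x => ‖f x‖ ^ 2 + ‖P x‖ ^ 2) := h1.add h2
  rw [integral_sub h12 h3', integral_add h1 h2, integral_const_mul] at h5
  have h6 : ∫ x, (conj (P x) * f x).re = torusVol d * ∑ k ∈ E, ‖fCoeff f k‖ ^ 2 := by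
    have := integral_re h3
    simp only [RCLike.re_to_complex] at this
    rw [this, hP, integral_conj_trigPoly_mul hfi]
    simp only [conj_mul_self_eq, ← Complex.ofReal_sum, ← Complex.ofReal_mul, Complex.ofReal_re]
  rw [h6, hP, integral_norm_sq_trigPoly] at h5
  linarith

lemma trigPoly_fCoeff_eq_integral {f : Torus d → ℂ} (hf : Integrable f)
    (E : Finset (Fin d → ℤ)) (M : (Fin d → ℤ) → ℂ) (x : Torus d) :
    torusVol d * trigPoly E (fun k => M k * fCoeff f k) x =
      ∫ y : Torus d, trigPoly E M (x - y) * f y := by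
  have h : ∀ y, trigPoly E M (x - y) * f y =
      ∑ k ∈ E, (M k * trigChar k x) * (conj (trigChar k y) * f y) := by
    intro y
    rw [trigPoly, Finset.sum_mul]
    refine Finset.sum_congr rfl fun k _ => ?_
    rw [sub_eq_add_neg, trigChar_add_point, trigChar_neg_point]
    ring
  simp only [h]
  rw [integral_finsetSum _ fun k _ => (integrable_conj_trigChar_mul hf k).const_mul _, trigPoly,
    Finset.mul_sum]
  refine Finset.sum_congr rfl fun k _ => ?_
  rw [integral_const_mul, integral_conj_trigChar_mul]
  ring

lemma norm_multiplier_le {f : Torus d → ℂ} (hf : Integrable f) {B : ℝ}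
    (hB : ∀ x, ‖f x‖ ≤ B) (E : Finset (Fin d → ℤ)) (M : (Fin d → ℤ) → ℂ) {K : ℝ}
    (hK : ∫ x, ‖trigPoly E M x‖ ≤ torusVol d * K) (x : Torus d) :
    ‖trigPoly E (fun k => M k * fCoeff f k) x‖ ≤ K * B := by
  have hV := torusVol_pos (d := d)
  have hB0 : 0 ≤ B := (norm_nonneg _).trans (hB 0)
  have hc : Continuous (trigPoly E M) := continuous_trigPoly E M
  have h1 : ∫ y : Torus d, ‖trigPoly E M (x - y)‖ = ∫ y : Torus d, ‖trigPoly E M y‖ := by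
    have h2 := measurePreserving_neg_torus.integral_comp (Homeomorph.neg (Torus d)).measurableEmbedding
      (fun y => ‖trigPoly E M (x + y)‖)
    simp only [← sub_eq_add_neg] at h2
    rw [h2]
    exact integral_add_left_eq_self (fun y => ‖trigPoly E M y‖) x
  have h3 : ‖∫ y : Torus d, trigPoly E M (x - y) * f y‖ ≤ ∫ y : Torus d, ‖trigPoly E M (x - y)‖ * B := by
    refine norm_integral_le_of_norm_le
      (integrable_of_continuous_torus (by fun_prop)) (Filter.Eventually.of_forall fun y => ?_)
    rw [norm_mul]
    exact mul_le_mul_of_nonneg_left (hB y) (norm_nonneg _)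
  rw [← trigPoly_fCoeff_eq_integral hf, integral_mul_const, h1, norm_mul, Complex.norm_real,
    Real.norm_of_nonneg hV.le] at h3
  have h4 : torusVol d * ‖trigPoly E (fun k => M k * fCoeff f k) x‖ ≤ torusVol d * (K * B) := by
    calc _ ≤ _ := h3
      _ ≤ torusVol d * K * B := mul_le_mul_of_nonneg_right hK hB0
      _ = _ := by ring
  exact le_of_mul_le_mul_left h4 hV

/-- The univariate trigonometric polynomial with frequencies in `A` and coefficients `φ`. -/
def uniPoly (A : Finset ℤ) (φ : ℤ → ℝ) (x : AddCircle (2 * π)) : ℂ :=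
  ∑ k ∈ A, (φ k : ℂ) * fourier k x

lemma continuous_uniPoly (A : Finset ℤ) (φ : ℤ → ℝ) : Continuous (uniPoly A φ) := by
  unfold uniPoly
  fun_prop

lemma integrable_of_continuous_circle {F : Type*} [NormedAddCommGroup F]
    {g : AddCircle (2 * π) → F} (hg : Continuous g) : Integrable g :=
  hg.integrable_of_hasCompactSupport (HasCompactSupport.of_compactSpace g)

lemma integral_fourier_circle (n : ℤ) :
    ∫ x : AddCircle (2 * π), fourier n x = if n = 0 then ((2 * π : ℝ) : ℂ) else 0 := by
  split_ifs with h
  · subst h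
    simp [Measure.real, AddCircle.measure_univ, pi_pos.le]
  · have h1 := integral_add_right_eq_self (μ := (volume : Measure (AddCircle (2 * π))))
      (fun x => fourier n x) ((2 * π / 2 / (n : ℝ) : ℝ) : AddCircle (2 * π))
    simp only [fourier_add_half_inv_index h (by positivity : 0 < 2 * π), integral_neg] at h1
    have : (2 : ℂ) * ∫ x : AddCircle (2 * π), fourier n x = 0 := by linear_combination -h1
    simpa using this

lemma integral_norm_sq_uniPoly_one (A : Finset ℤ) :
    ∫ x, ‖uniPoly A (fun _ => 1) x‖ ^ 2 = 2 * π * A.card := by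
  have h : ∀ x, ((‖uniPoly A (fun _ => 1) x‖ ^ 2 : ℝ) : ℂ) =
      ∑ a ∈ A, ∑ b ∈ A, fourier (b - a) x := by
    intro x
    rw [← conj_mul_self_eq, uniPoly, map_sum, Finset.sum_mul_sum]
    refine Finset.sum_congr rfl fun a _ => Finset.sum_congr rfl fun b _ => ?_
    rw [sub_eq_add_neg, fourier_add, fourier_neg]
    simp [mul_comm]
  apply Complex.ofReal_injective
  rw [← integral_complex_ofReal]
  simp only [h]
  rw [integral_finsetSum _ fun a _ => integrable_of_continuous_circle (by fun_prop)]
  have : ∀ a ∈ A, ∫ x : AddCircle (2 * π), ∑ b ∈ A, fourier (b - a) x = ((2 * π : ℝ) : ℂ) := by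
    intro a ha
    rw [integral_finsetSum _ fun b _ => integrable_of_continuous_circle (by fun_prop)]
    simp only [integral_fourier_circle, sub_eq_zero]
    rw [Finset.sum_ite_eq', if_pos ha]
  rw [Finset.sum_congr rfl this]
  simp [mul_comm]

/-- The trapezoidal (de la Vallée-Poussin type) multiplier at dyadic level `s`. -/
def vpMult (s : ℕ) (k : ℤ) : ℝ :=
  (((Finset.Ico (0 : ℤ) (2 ^ s)).filter
    fun b => k - b ∈ Finset.Ioo (-2 ^ (s + 1) : ℤ) (2 ^ s)).card : ℝ) / 2 ^ s

lemma vpMult_nonneg (s : ℕ) (k : ℤ) : 0 ≤ vpMult s k := by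
  unfold vpMult; positivity

lemma card_Ico_two_pow (s : ℕ) : ((Finset.Ico (0 : ℤ) (2 ^ s)).card : ℝ) = 2 ^ s := by
  rw [Int.card_Ico, sub_zero]
  have : (((2 ^ s : ℤ).toNat : ℤ) : ℝ) = 2 ^ s := by
    rw [Int.toNat_of_nonneg (by positivity)]; push_cast; rfl
  exact_mod_cast this

lemma vpMult_le_one (s : ℕ) (k : ℤ) : vpMult s k ≤ 1 := by
  unfold vpMult
  rw [div_le_one (by positivity), ← card_Ico_two_pow s]
  exact_mod_cast Finset.card_filter_le _ _

lemma vpMult_eq_one {s : ℕ} {k : ℤ} (h : |k| < 2 ^ s) : vpMult s k = 1 := by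
  unfold vpMult
  rw [Finset.filter_true_of_mem, card_Ico_two_pow, div_self (by positivity)]
  intro b hb
  rw [Finset.mem_Ico] at hb
  rw [abs_lt] at h
  rw [Finset.mem_Ioo, pow_succ]
  constructor <;> linarith

lemma abs_lt_of_vpMult_ne_zero {s : ℕ} {k : ℤ} (h : vpMult s k ≠ 0) : |k| < 2 ^ (s + 1) := by
  by_contra hk
  apply h
  unfold vpMult
  rw [Finset.filter_false_of_mem]
  · simp
  intro b hb hkb
  apply hk
  rw [Finset.mem_Ico] at hb
  rw [Finset.mem_Ioo] at hkb
  rw [abs_lt]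
  rw [pow_succ] at *
  constructor <;> linarith

lemma uniPoly_vpMult {s : ℕ} {A : Finset ℤ} (hA : ∀ k : ℤ, |k| < 2 ^ (s + 1) → k ∈ A)
    (x : AddCircle (2 * π)) :
    uniPoly A (vpMult s) x = ((2 ^ s : ℝ) : ℂ)⁻¹ *
      (uniPoly (Finset.Ioo (-2 ^ (s + 1) : ℤ) (2 ^ s)) (fun _ => 1) x *
        uniPoly (Finset.Ico (0 : ℤ) (2 ^ s)) (fun _ => 1) x) := by
  set S := Finset.Ioo (-2 ^ (s + 1) : ℤ) (2 ^ s) with hS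
  set B := Finset.Ico (0 : ℤ) (2 ^ s) with hB
  have h1 : ∀ b ∈ B, ∑ a ∈ S, fourier (a + b) x =
      ∑ k ∈ A, if k - b ∈ S then fourier k x else 0 := by
    intro b hb
    rw [← Finset.sum_filter]
    refine Finset.sum_bij (fun a _ => a + b) ?_ ?_ ?_ ?_
    · intro a ha
      rw [Finset.mem_filter]
      refine ⟨hA _ ?_, by simpa using ha⟩
      rw [hB, Finset.mem_Ico] at hb
      rw [hS, Finset.mem_Ioo] at ha
      rw [abs_lt]
      rw [pow_succ] at *
      constructor <;> linarith
    · intro a _ a' _ h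
      simpa using h
    · intro k hk
      rw [Finset.mem_filter] at hk
      exact ⟨k - b, hk.2, by ring⟩
    · intros; rfl
  have h2 : uniPoly S (fun _ => 1) x * uniPoly B (fun _ => 1) x =
      ∑ k ∈ A, ((B.filter fun b => k - b ∈ S).card : ℂ) * fourier k x := by
    simp only [uniPoly, Complex.ofReal_one, one_mul]
    rw [mul_comm, Finset.sum_mul_sum]
    calc ∑ b ∈ B, ∑ a ∈ S, fourier b x * fourier a x
        = ∑ b ∈ B, ∑ k ∈ A, if k - b ∈ S then fourier k x else 0 := by
          refine Finset.sum_congr rfl fun b hb => ?_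
          rw [← h1 b hb]
          refine Finset.sum_congr rfl fun a _ => ?_
          rw [fourier_add, mul_comm]
      _ = _ := by
          rw [Finset.sum_comm]
          refine Finset.sum_congr rfl fun k _ => ?_
          rw [← Finset.sum_filter, Finset.sum_const, nsmul_eq_mul]
  rw [h2, uniPoly, Finset.mul_sum]
  refine Finset.sum_congr rfl fun k _ => ?_
  unfold vpMult
  push_cast
  ring

lemma integral_norm_uniPoly_vpMult_le {s : ℕ} {A : Finset ℤ}
    (hA : ∀ k : ℤ, |k| < 2 ^ (s + 1) → k ∈ A) :
    ∫ x, ‖uniPoly A (vpMult s) x‖ ≤ 2 * π * 2 := by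
  set S := Finset.Ioo (-2 ^ (s + 1) : ℤ) (2 ^ s) with hS
  set B := Finset.Ico (0 : ℤ) (2 ^ s) with hB
  have hSc : (S.card : ℝ) ≤ 3 * 2 ^ s := by
    have h1 : S ⊆ Finset.Ico (-2 ^ (s + 1) : ℤ) (2 ^ s) := Finset.Ioo_subset_Ico_self
    have h2 := Finset.card_le_card h1
    rw [Int.card_Ico] at h2
    have h3 : ((2 ^ s - -2 ^ (s + 1) : ℤ).toNat : ℤ) = 3 * 2 ^ s := by
      rw [Int.toNat_of_nonneg (by have : (0 : ℤ) < 2 ^ s := by positivity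
                                  rw [pow_succ]; linarith)]
      ring
    have h4 : (S.card : ℤ) ≤ 3 * 2 ^ s := by
      rw [← h3]; exact_mod_cast h2
    exact_mod_cast h4
  have hBc : (B.card : ℝ) = 2 ^ s := card_Ico_two_pow s
  have hSi : Integrable (fun x => ‖uniPoly S (fun _ => 1) x‖ ^ 2) :=
    integrable_of_continuous_circle (by have := continuous_uniPoly S (fun _ => 1); fun_prop)
  have hBi : Integrable (fun x => ‖uniPoly B (fun _ => 1) x‖ ^ 2) :=
    integrable_of_continuous_circle (by have := continuous_uniPoly B (fun _ => 1); fun_prop)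
  have hp : (0 : ℝ) < 2 ^ s := by positivity
  calc ∫ x, ‖uniPoly A (vpMult s) x‖
      ≤ ∫ x, (2 ^ s : ℝ)⁻¹ / 2 * (‖uniPoly S (fun _ => 1) x‖ ^ 2 + ‖uniPoly B (fun _ => 1) x‖ ^ 2) := by
        refine integral_mono ?_ ((hSi.add hBi).const_mul _) fun x => ?_
        · exact integrable_of_continuous_circle (continuous_uniPoly A _).norm
        · simp only
          rw [uniPoly_vpMult hA, norm_mul, norm_mul, norm_inv, Complex.norm_real,
            Real.norm_of_nonneg hp.le, div_mul_eq_mul_div, mul_div_assoc]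
          refine mul_le_mul_of_nonneg_left ?_ (by positivity)
          linarith [two_mul_le_add_sq ‖uniPoly S (fun _ => 1) x‖ ‖uniPoly B (fun _ => 1) x‖]
    _ = (2 ^ s : ℝ)⁻¹ / 2 * (2 * π * S.card + 2 * π * B.card) := by
        rw [integral_const_mul, integral_add hSi hBi, integral_norm_sq_uniPoly_one,
          integral_norm_sq_uniPoly_one]
    _ ≤ (2 ^ s : ℝ)⁻¹ / 2 * (2 * π * (3 * 2 ^ s) + 2 * π * 2 ^ s) := by
        rw [hBc]; gcongr
    _ = 2 * π * 2 := by field_simp; ring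

/-- The smooth dyadic band multiplier at level `s`. -/
def bandMult (s : ℕ) (k : ℤ) : ℝ :=
  vpMult s k - if s < 2 then 0 else vpMult (s - 2) k

lemma abs_bandMult_le_one (s : ℕ) (k : ℤ) : |bandMult s k| ≤ 1 := by
  unfold bandMult
  have h1 := vpMult_nonneg s k
  have h2 := vpMult_le_one s k
  have h3 := vpMult_nonneg (s - 2) k
  have h4 := vpMult_le_one (s - 2) k
  rw [abs_le]
  split_ifs <;> constructor <;> linarith

lemma natAbs_size_le_iff {k : ℤ} {s : ℕ} : k.natAbs.size ≤ s ↔ |k| < 2 ^ s := by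
  rw [Nat.size_le, Int.abs_eq_natAbs]
  exact_mod_cast Iff.rfl

lemma bandMult_eq_one {s : ℕ} {k : ℤ} (h : k.natAbs.size = s) : bandMult s k = 1 := by
  unfold bandMult
  rw [vpMult_eq_one (natAbs_size_le_iff.1 h.le)]
  split_ifs with hs
  · simp
  · have : vpMult (s - 2) k = 0 := by
      by_contra hne
      have := natAbs_size_le_iff.2 (abs_lt_of_vpMult_ne_zero hne)
      omega
    rw [this, sub_zero]

lemma size_le_of_bandMult_ne_zero {s : ℕ} {k : ℤ} (h : bandMult s k ≠ 0) :
    k.natAbs.size ≤ s + 1 := by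
  by_contra hc
  apply h
  have h1 : vpMult s k = 0 := by
    by_contra hne
    exact hc (natAbs_size_le_iff.2 (abs_lt_of_vpMult_ne_zero hne))
  have h2 : vpMult (s - 2) k = 0 := by
    by_contra hne
    have := natAbs_size_le_iff.2 (abs_lt_of_vpMult_ne_zero hne)
    omega
  simp [bandMult, h1, h2]

lemma le_size_of_bandMult_ne_zero {s : ℕ} {k : ℤ} (h : bandMult s k ≠ 0) :
    s ≤ k.natAbs.size + 1 := by
  by_contra hc
  apply h
  have h1 : vpMult s k = 1 := vpMult_eq_one (natAbs_size_le_iff.1 (by omega))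
  have h2 : vpMult (s - 2) k = 1 := vpMult_eq_one (natAbs_size_le_iff.1 (by omega))
  have h3 : ¬ s < 2 := by omega
  simp [bandMult, h1, h2, h3]

lemma sum_bandMult_sq_le (S : Finset ℕ) (k : ℤ) : ∑ s ∈ S, bandMult s k ^ 2 ≤ 3 := by
  set t := k.natAbs.size
  have h1 : ∀ s ∈ S, bandMult s k ^ 2 ≤ if s ∈ Finset.Icc (t - 1) (t + 1) then 1 else 0 := by
    intro s _
    split_ifs with hs
    · rw [sq_le_one_iff_abs_le_one]; exact abs_bandMult_le_one s k
    · have : bandMult s k = 0 := by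
        by_contra hne
        have h2 := size_le_of_bandMult_ne_zero hne
        have h3 := le_size_of_bandMult_ne_zero hne
        exact hs (Finset.mem_Icc.2 ⟨by omega, by omega⟩)
      rw [this]; norm_num
  refine (Finset.sum_le_sum h1).trans ?_
  rw [← Finset.sum_filter, Finset.sum_const, nsmul_eq_mul, mul_one]
  have h2 : S.filter (fun s => s ∈ Finset.Icc (t - 1) (t + 1)) ⊆ Finset.Icc (t - 1) (t + 1) :=
    fun s hs => (Finset.mem_filter.1 hs).2
  have h3 := Finset.card_le_card h2
  rw [Nat.card_Icc] at h3
  exact_mod_cast h3.trans (by omega)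

lemma integral_norm_uniPoly_bandMult_le {s : ℕ} {A : Finset ℤ}
    (hA : ∀ k : ℤ, |k| < 2 ^ (s + 1) → k ∈ A) :
    ∫ x, ‖uniPoly A (bandMult s) x‖ ≤ 2 * π * 4 := by
  have h1 := integral_norm_uniPoly_vpMult_le hA
  by_cases hs : s < 2
  · have : bandMult s = vpMult s := by funext k; simp [bandMult, hs]
    rw [this]
    nlinarith [pi_pos]
  · have hA' : ∀ k : ℤ, |k| < 2 ^ (s - 2 + 1) → k ∈ A := by
      intro k hk
      refine hA k (hk.trans_le ?_)
      exact pow_le_pow_right₀ (by norm_num) (by omega)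
    have h2 := integral_norm_uniPoly_vpMult_le hA'
    have hi : ∀ φ, Integrable (fun x => ‖uniPoly A φ x‖) := fun φ =>
      integrable_of_continuous_circle (continuous_uniPoly A φ).norm
    calc ∫ x, ‖uniPoly A (bandMult s) x‖
        ≤ ∫ x, (‖uniPoly A (vpMult s) x‖ + ‖uniPoly A (vpMult (s - 2)) x‖) := by
          refine integral_mono (hi _) ((hi _).add (hi _)) fun x => ?_
          have : uniPoly A (bandMult s) x =
              uniPoly A (vpMult s) x - uniPoly A (vpMult (s - 2)) x := by
            simp [uniPoly, bandMult, hs, sub_mul, Finset.sum_sub_distrib]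
          simp only
          rw [this]
          exact norm_sub_le _ _
      _ ≤ _ := by
          rw [integral_add (hi _) (hi _)]
          linarith

lemma integral_norm_tensor_trigPoly_le (A : Fin d → Finset ℤ) (φ : Fin d → ℤ → ℝ) {K : ℝ}
    (hK : ∀ j, ∫ x, ‖uniPoly (A j) (φ j) x‖ ≤ 2 * π * K) :
    ∫ x, ‖trigPoly (Fintype.piFinset A) (fun k => ((∏ j, φ j (k j) : ℝ) : ℂ)) x‖ ≤
      torusVol d * K ^ d := by
  have h : ∀ x : Torus d, ‖trigPoly (Fintype.piFinset A) (fun k => ((∏ j, φ j (k j) : ℝ) : ℂ)) x‖ =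
      ∏ j, ‖uniPoly (A j) (φ j) (x j)‖ := by
    intro x
    rw [← norm_prod]
    congr 1
    simp only [uniPoly]
    rw [Finset.prod_univ_sum, trigPoly]
    refine Finset.sum_congr rfl fun k _ => ?_
    rw [trigChar_apply, Complex.ofReal_prod, Finset.prod_mul_distrib]
  simp only [h]
  rw [integral_fintype_prod_volume_eq_prod (fun j (y : AddCircle (2 * π)) => ‖uniPoly (A j) (φ j) y‖)]
  calc _ ≤ ∏ _j : Fin d, (2 * π * K) :=
        Finset.prod_le_prod (fun j _ => integral_nonneg fun y => norm_nonneg _) fun j _ => hK j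
    _ = _ := by rw [Finset.prod_const, Finset.card_univ, Fintype.card_fin, torusVol, mul_pow]

/-- Trigonometric polynomials all of whose frequencies have positive `j`-th coordinate. -/
def posSpan (d : ℕ) (j : Fin d) : Submodule ℂ (Torus d → ℂ) :=
  Submodule.span ℂ {f | ∃ k : Fin d → ℤ, 0 < k j ∧ f = fun x => trigChar k x}

lemma trigChar_mem_posSpan {j : Fin d} {k : Fin d → ℤ} (hk : 0 < k j) :
    (fun x => trigChar k x) ∈ posSpan d j :=
  Submodule.subset_span ⟨k, hk, rfl⟩

lemma posSpan_mul_le (j : Fin d) : posSpan d j * posSpan d j ≤ posSpan d j := by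
  unfold posSpan
  rw [Submodule.span_mul_span]
  refine Submodule.span_mono ?_
  rintro _ ⟨_, ⟨k, hk, rfl⟩, _, ⟨l, hl, rfl⟩, rfl⟩
  refine ⟨k + l, by simpa using add_pos hk hl, ?_⟩
  funext x
  simp [trigChar_add]

lemma pow_mem_posSpan {j : Fin d} {P : Torus d → ℂ} (hP : P ∈ posSpan d j) (n : ℕ) :
    P ^ (n + 1) ∈ posSpan d j := by
  induction n with
  | zero => simpa using hP
  | succ n ih =>
    rw [pow_succ]
    exact posSpan_mul_le j (Submodule.mul_mem_mul ih hP)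

lemma continuous_and_integral_eq_zero_of_mem_posSpan {j : Fin d} {P : Torus d → ℂ}
    (hP : P ∈ posSpan d j) : Continuous P ∧ ∫ x, P x = 0 := by
  induction hP using Submodule.span_induction with
  | mem P h =>
    obtain ⟨k, hk, rfl⟩ := h
    refine ⟨by fun_prop, ?_⟩
    rw [integral_trigChar, if_neg]
    rintro rfl
    simp at hk
  | zero => exact ⟨continuous_zero, by simp⟩
  | add P Q _ _ hP hQ =>
    refine ⟨hP.1.add hQ.1, ?_⟩
    simp only [Pi.add_apply]
    rw [integral_add (integrable_of_continuous_torus hP.1) (integrable_of_continuous_torus hQ.1),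
      hP.2, hQ.2, add_zero]
  | smul a P _ hP =>
    refine ⟨hP.1.const_smul a, ?_⟩
    simp only [Pi.smul_apply]
    rw [integral_smul, hP.2, smul_zero]

lemma norm_pow_sub_pow_le_add_pow (x y : ℂ) (n : ℕ) :
    ‖x ^ n - y ^ n‖ ≤ (‖x - y‖ + ‖y‖) ^ n - ‖y‖ ^ n := by
  induction n with
  | zero => simp
  | succ n ih =>
    have h : x ^ (n + 1) - y ^ (n + 1) = x * (x ^ n - y ^ n) + (x - y) * y ^ n := by ring
    have hx : ‖x‖ ≤ ‖x - y‖ + ‖y‖ := by simpa using norm_add_le (x - y) y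
    rw [h]
    calc _ ≤ ‖x‖ * ‖x ^ n - y ^ n‖ + ‖x - y‖ * ‖y‖ ^ n := by
          refine (norm_add_le _ _).trans ?_
          rw [norm_mul, norm_mul, norm_pow]
      _ ≤ (‖x - y‖ + ‖y‖) * ((‖x - y‖ + ‖y‖) ^ n - ‖y‖ ^ n) + ‖x - y‖ * ‖y‖ ^ n := by
          gcongr
      _ = _ := by ring

lemma exists_pow_mul_add_pow_sub_le (r : ℕ) : ∃ C : ℝ, 0 < C ∧ ∀ a b : ℝ, 0 ≤ a → 0 ≤ b →
    b ^ r * ((a + b) ^ r - b ^ r) ≤ b ^ (2 * r) / 2 + C * a ^ (2 * r) := by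
  obtain ⟨ε, hε, hεr⟩ : ∃ ε : ℝ, 0 < ε ∧ (1 + ε) ^ r ≤ 3 / 2 := by
    have h1 : Filter.Tendsto (fun ε : ℝ => (1 + ε) ^ r) (nhds 0) (nhds 1) := by
      have : Continuous (fun ε : ℝ => (1 + ε) ^ r) := by fun_prop
      simpa using this.tendsto 0
    have h2 : ∀ᶠ ε in nhds (0 : ℝ), (1 + ε) ^ r < 3 / 2 := h1.eventually_lt_const (by norm_num)
    have h3 : ∀ᶠ ε in nhdsWithin (0 : ℝ) (Set.Ioi 0), (1 + ε) ^ r < 3 / 2 :=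
      h2.filter_mono nhdsWithin_le_nhds
    obtain ⟨ε, h4, h5⟩ := (h3.and self_mem_nhdsWithin).exists
    exact ⟨ε, h5, h4.le⟩
  refine ⟨(1 / ε) ^ r * (1 + 1 / ε) ^ r, by positivity, fun a b ha hb => ?_⟩
  have hpow : ∀ t : ℝ, t ^ (2 * r) = t ^ r * t ^ r := fun t => by rw [two_mul, pow_add]
  rcases le_total a (ε * b) with h | h
  · have h1 : (a + b) ^ r ≤ 3 / 2 * b ^ r := by
      calc (a + b) ^ r ≤ ((1 + ε) * b) ^ r := by gcongr; linarith
        _ = (1 + ε) ^ r * b ^ r := mul_pow _ _ _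
        _ ≤ _ := by gcongr
    have h2 : b ^ r * ((a + b) ^ r - b ^ r) ≤ b ^ r * (b ^ r / 2) := by
      gcongr; linarith
    have h3 : 0 ≤ (1 / ε) ^ r * (1 + 1 / ε) ^ r * a ^ (2 * r) := by positivity
    rw [hpow b]
    linarith
  · have hb' : b ≤ 1 / ε * a := by
      rw [one_div, inv_mul_eq_div, le_div_iff₀ hε]; linarith
    have h1 : b ^ r * ((a + b) ^ r - b ^ r) ≤ (1 / ε * a) ^ r * ((1 + 1 / ε) * a) ^ r := by
      have h2 : (a + b) ^ r - b ^ r ≤ ((1 + 1 / ε) * a) ^ r := by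
        have h3 : (a + b) ^ r ≤ ((1 + 1 / ε) * a) ^ r := by gcongr; linarith
        have : 0 ≤ b ^ r := by positivity
        linarith
      have h4 : 0 ≤ (a + b) ^ r - b ^ r := by
        rw [sub_nonneg]; gcongr; linarith
      gcongr
    rw [mul_pow, mul_pow] at h1
    have h5 : 0 ≤ b ^ (2 * r) / 2 := by positivity
    rw [hpow a]
    linarith

lemma exists_integral_pow_le_real_part (r : ℕ) (hr : 1 ≤ r) : ∃ C : ℝ, 0 < C ∧
    ∀ (d : ℕ) (j : Fin d) (P : Torus d → ℂ), P ∈ posSpan d j →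
      ∫ x, ‖P x‖ ^ (2 * r) ≤ C * ∫ x, ‖P x + conj (P x)‖ ^ (2 * r) := by
  obtain ⟨C, hC, hCr⟩ := exists_pow_mul_add_pow_sub_le r
  refine ⟨2 * C, by positivity, fun d j P hP => ?_⟩
  have hPc := (continuous_and_integral_eq_zero_of_mem_posSpan hP).1
  have h0 : ∫ x, P x ^ (2 * r) = 0 := by
    have := (continuous_and_integral_eq_zero_of_mem_posSpan (pow_mem_posSpan hP (2 * r - 1))).2
    rw [show 2 * r - 1 + 1 = 2 * r by omega] at this
    simpa using this
  set u : Torus d → ℂ := fun x => P x + conj (P x) with hu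
  have huc : Continuous u := by fun_prop
  have h1 : ∀ x, ((‖P x‖ ^ (2 * r) : ℝ) : ℂ) =
      P x ^ r * ((u x - P x) ^ r - (-P x) ^ r) + (-1) ^ r * P x ^ (2 * r) := by
    intro x
    have h2 : ((‖P x‖ ^ (2 * r) : ℝ) : ℂ) = (P x) ^ r * (conj (P x)) ^ r := by
      rw [pow_mul, Complex.ofReal_pow, ← conj_mul_self_eq, mul_pow, mul_comm]
    rw [h2, hu]
    simp only [add_sub_cancel_left]
    rw [neg_pow (P x), two_mul, pow_add]
    ring
  have h3 : ∫ x, ‖P x‖ ^ (2 * r) ≤ ∫ x, ‖P x ^ r * ((u x - P x) ^ r - (-P x) ^ r)‖ := by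
    have h4 : ((∫ x, ‖P x‖ ^ (2 * r) : ℝ) : ℂ) =
        ∫ x, P x ^ r * ((u x - P x) ^ r - (-P x) ^ r) := by
      rw [← integral_complex_ofReal]
      simp only [h1]
      rw [integral_add (integrable_of_continuous_torus (by fun_prop))
        (integrable_of_continuous_torus (by fun_prop)), integral_const_mul, h0, mul_zero, add_zero]
    have h5 : 0 ≤ ∫ x, ‖P x‖ ^ (2 * r) := integral_nonneg fun x => by positivity
    calc ∫ x, ‖P x‖ ^ (2 * r) = ‖((∫ x, ‖P x‖ ^ (2 * r) : ℝ) : ℂ)‖ := by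
          rw [Complex.norm_real, Real.norm_of_nonneg h5]
      _ ≤ _ := by rw [h4]; exact norm_integral_le_integral_norm _
  have h6 : ∫ x, ‖P x ^ r * ((u x - P x) ^ r - (-P x) ^ r)‖ ≤
      ∫ x, (‖P x‖ ^ (2 * r) / 2 + C * ‖u x‖ ^ (2 * r)) := by
    refine integral_mono (integrable_of_continuous_torus (by fun_prop))
      (integrable_of_continuous_torus (by fun_prop)) fun x => ?_
    simp only
    rw [norm_mul, norm_pow]
    refine le_trans ?_ (hCr ‖u x‖ ‖P x‖ (norm_nonneg _) (norm_nonneg _))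
    have := norm_pow_sub_pow_le_add_pow (u x - P x) (-P x) r
    rw [norm_neg, sub_neg_eq_add, sub_add_cancel] at this
    gcongr
  rw [integral_add (integrable_of_continuous_torus (by fun_prop))
        (integrable_of_continuous_torus (by fun_prop)), integral_const_mul, integral_div] at h6
  change _ ≤ 2 * C * ∫ x, ‖u x‖ ^ (2 * r)
  linarith

lemma pow_le_add_of_le_half_add {a b c : ℝ} (ha : 0 ≤ a) (hb : 0 ≤ b) (hc : 0 ≤ c)
    (h : a ≤ (b + c) / 2) (n : ℕ) : a ^ n ≤ b ^ n + c ^ n := by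
  rcases le_total b c with hbc | hbc
  · have : a ^ n ≤ c ^ n := by gcongr; linarith
    have : 0 ≤ b ^ n := by positivity
    linarith
  · have : a ^ n ≤ b ^ n := by gcongr; linarith
    have : 0 ≤ c ^ n := by positivity
    linarith

lemma exists_integral_pow_le_analytic_part (r : ℕ) (hr : 1 ≤ r) : ∃ C : ℝ, 0 < C ∧
    ∀ (d : ℕ) (j : Fin d) (P N : Torus d → ℂ), P ∈ posSpan d j →
      (fun x => conj (N x)) ∈ posSpan d j →
      ∫ x, ‖P x‖ ^ (2 * r) ≤ C * ∫ x, ‖P x + N x‖ ^ (2 * r) := by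
  obtain ⟨C, hC, hCr⟩ := exists_integral_pow_le_real_part r hr
  refine ⟨2 * (C * 2 ^ (2 * r)), by positivity, fun d j P N hP hN => ?_⟩
  set N' : Torus d → ℂ := fun x => conj (N x) with hN'
  have hPc := (continuous_and_integral_eq_zero_of_mem_posSpan hP).1
  have hN'c := (continuous_and_integral_eq_zero_of_mem_posSpan hN).1
  have hNc : Continuous N := by
    have : N = fun x => conj (N' x) := by funext x; simp [hN']
    rw [this]; fun_prop
  have key : ∀ Q ∈ posSpan d j, (∀ x, ‖Q x + conj (Q x)‖ ≤ 2 * ‖P x + N x‖) →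
      ∫ x, ‖Q x‖ ^ (2 * r) ≤ C * 2 ^ (2 * r) * ∫ x, ‖P x + N x‖ ^ (2 * r) := by
    intro Q hQ hle
    have hQc := (continuous_and_integral_eq_zero_of_mem_posSpan hQ).1
    refine (hCr d j Q hQ).trans ?_
    rw [mul_assoc]
    refine mul_le_mul_of_nonneg_left ?_ hC.le
    rw [← integral_const_mul]
    refine integral_mono (integrable_of_continuous_torus (by fun_prop))
      (integrable_of_continuous_torus (by fun_prop)) fun x => ?_
    simp only
    rw [← mul_pow]
    exact pow_le_pow_left₀ (norm_nonneg _) (hle x) _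
  have h1 := key (P + N') (Submodule.add_mem _ hP hN) (by
    intro x
    have : (P + N') x + conj ((P + N') x) = (P x + N x) + conj (P x + N x) := by
      simp [hN']; ring
    rw [this]
    refine (norm_add_le _ _).trans ?_
    rw [RCLike.norm_conj]; linarith)
  have h2 := key (Complex.I • (P - N'))
    (Submodule.smul_mem _ _ (Submodule.sub_mem _ hP hN)) (by
    intro x
    have : (Complex.I • (P - N')) x + conj ((Complex.I • (P - N')) x) =
        Complex.I * (P x + N x) - Complex.I * conj (P x + N x) := by
      simp [hN']; ring
    rw [this]
    refine (norm_sub_le _ _).trans ?_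
    rw [norm_mul, norm_mul, RCLike.norm_conj, Complex.norm_I]; linarith)
  have h3 : ∫ x, ‖P x‖ ^ (2 * r) ≤
      ∫ x, (‖(P + N') x‖ ^ (2 * r) + ‖(Complex.I • (P - N')) x‖ ^ (2 * r)) := by
    refine integral_mono (integrable_of_continuous_torus (by fun_prop))
      (integrable_of_continuous_torus ?_) fun x => ?_
    · simp only [Pi.add_apply, Pi.smul_apply, Pi.sub_apply]; fun_prop
    · refine pow_le_add_of_le_half_add (norm_nonneg _) (norm_nonneg _) (norm_nonneg _) ?_ _
      have : P x = ((P + N') x + (P - N') x) / 2 := by simp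
      rw [Pi.smul_apply, norm_smul, Complex.norm_I, one_mul]
      calc ‖P x‖ = ‖((P + N') x + (P - N') x) / 2‖ := by rw [← this]
        _ ≤ _ := by
          rw [norm_div, Complex.norm_ofNat]
          gcongr
          exact norm_add_le _ _
  rw [integral_add] at h3
  · linarith
  · refine integrable_of_continuous_torus ?_
    simp only [Pi.add_apply]; fun_prop
  · refine integrable_of_continuous_torus ?_
    simp only [Pi.smul_apply, Pi.sub_apply]; fun_prop

/-- The sharp frequency cut-off to `p` is bounded on `L_{2 * r}`, with constant `C` for the
`(2 * r)`-th powers of the norms. -/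
def CutoffBounded (d r : ℕ) (C : ℝ) (p : (Fin d → ℤ) → Prop) : Prop :=
  ∀ (E F : Finset (Fin d → ℤ)) (c : (Fin d → ℤ) → ℂ), (∀ k, k ∈ F ↔ k ∈ E ∧ p k) →
    ∫ x, ‖trigPoly F c x‖ ^ (2 * r) ≤ C * ∫ x, ‖trigPoly E c x‖ ^ (2 * r)

lemma exists_cutoffBounded_halfspace (r : ℕ) (hr : 1 ≤ r) : ∃ C : ℝ, 0 < C ∧
    ∀ (d : ℕ) (j : Fin d) (a : ℤ), CutoffBounded d r C (fun k => a ≤ k j) := by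
  obtain ⟨C, hC, hCr⟩ := exists_integral_pow_le_analytic_part r hr
  refine ⟨C, hC, fun d j a E F c hF => ?_⟩
  obtain rfl : F = E.filter fun k => a ≤ k j := by ext k; rw [hF, Finset.mem_filter]
  set e : Fin d → ℤ := Pi.single j (1 - 2 * a) with he
  have hej : e j = 1 - 2 * a := by simp [he]
  set U : Finset (Fin d → ℤ) → Torus d → ℂ :=
    fun S x => trigChar e x * trigPoly S c (2 • x) with hU
  have hUe : ∀ S, U S = ∑ k ∈ S, c k • fun x => trigChar (e + (k + k)) x := by
    intro S
    funext x
    simp only [hU, trigPoly, Finset.mul_sum, Finset.sum_apply, Pi.smul_apply, smul_eq_mul]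
    refine Finset.sum_congr rfl fun k _ => ?_
    rw [trigChar_two_nsmul_point, trigChar_add e]
    ring
  have hUn : ∀ S, ∫ x, ‖U S x‖ ^ (2 * r) = ∫ x, ‖trigPoly S c x‖ ^ (2 * r) := by
    intro S
    simp only [hU, norm_mul, norm_trigChar, one_mul]
    have hm := measurePreserving_two_nsmul_torus (d := d)
    have hc : Continuous (fun y => ‖trigPoly S c y‖ ^ (2 * r)) := by
      have := continuous_trigPoly S c
      fun_prop
    have := integral_map (μ := (volume : Measure (Torus d))) hm.measurable.aemeasurable
      (f := fun y => ‖trigPoly S c y‖ ^ (2 * r)) hc.aestronglyMeasurable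
    rw [hm.map_eq] at this
    exact this.symm
  have hP : U (E.filter fun k => a ≤ k j) ∈ posSpan d j := by
    rw [hUe]
    refine Submodule.sum_mem _ fun k hk => Submodule.smul_mem _ _ (trigChar_mem_posSpan ?_)
    have := (Finset.mem_filter.1 hk).2
    simp only [Pi.add_apply, hej]; linarith
  have hN : (fun x => conj (U (E.filter fun k => ¬ a ≤ k j) x)) ∈ posSpan d j := by
    have : (fun x => conj (U (E.filter fun k => ¬ a ≤ k j) x)) =
        ∑ k ∈ E.filter (fun k => ¬ a ≤ k j), conj (c k) • fun x => trigChar (-(e + (k + k))) x := by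
      rw [hUe]
      funext x
      simp only [Finset.sum_apply, Pi.smul_apply, smul_eq_mul, map_sum, map_mul, trigChar_neg]
    rw [this]
    refine Submodule.sum_mem _ fun k hk => Submodule.smul_mem _ _ (trigChar_mem_posSpan ?_)
    have := (Finset.mem_filter.1 hk).2
    simp only [Pi.neg_apply, Pi.add_apply, hej]; linarith
  have hsum : ∀ x, U (E.filter fun k => a ≤ k j) x + U (E.filter fun k => ¬ a ≤ k j) x = U E x := by
    intro x
    simp only [hU, ← mul_add, trigPoly]
    rw [Finset.sum_filter_add_sum_filter_not]
  have := hCr d j _ _ hP hN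
  simp only [hsum] at this
  rwa [hUn, hUn] at this

lemma CutoffBounded.and {r : ℕ} {C C' : ℝ} {p q : (Fin d → ℤ) → Prop}
    (hp : CutoffBounded d r C p) (hq : CutoffBounded d r C' q) (hC' : 0 ≤ C') :
    CutoffBounded d r (C' * C) (fun k => p k ∧ q k) := by
  intro E F c hF
  have h := hq (E.filter p) F c fun k => by rw [hF, Finset.mem_filter, and_assoc]
  rw [mul_assoc]
  exact h.trans (mul_le_mul_of_nonneg_left (hp E _ c fun k => Finset.mem_filter) hC')

lemma CutoffBounded.not {r : ℕ} {C : ℝ} {p : (Fin d → ℤ) → Prop} (hp : CutoffBounded d r C p) :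
    CutoffBounded d r (2 ^ (2 * r) * (1 + C)) (fun k => ¬ p k) := by
  intro E F c hF
  obtain rfl : F = E.filter fun k => ¬ p k := by ext k; rw [hF, Finset.mem_filter]
  have hc := continuous_trigPoly E c
  have hc' := continuous_trigPoly (E.filter p) c
  have hc'' := continuous_trigPoly (E.filter fun k => ¬ p k) c
  have h1 : ∀ x, ‖trigPoly (E.filter fun k => ¬ p k) c x‖ ^ (2 * r) ≤
      2 ^ (2 * r) * (‖trigPoly E c x‖ ^ (2 * r) + ‖trigPoly (E.filter p) c x‖ ^ (2 * r)) := by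
    intro x
    have h2 : trigPoly (E.filter fun k => ¬ p k) c x =
        trigPoly E c x - trigPoly (E.filter p) c x := by
      rw [eq_sub_iff_add_eq, add_comm]
      simp only [trigPoly]
      rw [Finset.sum_filter_add_sum_filter_not]
    have h3 : ‖trigPoly (E.filter fun k => ¬ p k) c x‖ / 2 ≤
        (‖trigPoly E c x‖ + ‖trigPoly (E.filter p) c x‖) / 2 := by
      rw [h2]; gcongr; exact norm_sub_le _ _
    have h4 := pow_le_add_of_le_half_add (by positivity) (norm_nonneg _) (norm_nonneg _) h3 (2 * r)
    rw [div_pow, div_le_iff₀ (by positivity)] at h4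
    linarith
  calc _ ≤ ∫ x, 2 ^ (2 * r) * (‖trigPoly E c x‖ ^ (2 * r) +
          ‖trigPoly (E.filter p) c x‖ ^ (2 * r)) :=
        integral_mono (integrable_of_continuous_torus (by fun_prop))
          (integrable_of_continuous_torus (by fun_prop)) h1
    _ = 2 ^ (2 * r) * ((∫ x, ‖trigPoly E c x‖ ^ (2 * r)) +
          ∫ x, ‖trigPoly (E.filter p) c x‖ ^ (2 * r)) := by
        rw [integral_const_mul, integral_add (integrable_of_continuous_torus (by fun_prop))
          (integrable_of_continuous_torus (by fun_prop))]
    _ ≤ 2 ^ (2 * r) * ((∫ x, ‖trigPoly E c x‖ ^ (2 * r)) +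
          C * ∫ x, ‖trigPoly E c x‖ ^ (2 * r)) := by
        gcongr
        exact hp E _ c fun k => Finset.mem_filter
    _ = _ := by ring

lemma CutoffBounded.forall_mem {r : ℕ} {C : ℝ} (hC : 0 ≤ C) {ι : Type*} (S : Finset ι)
    {p : ι → (Fin d → ℤ) → Prop} (hp : ∀ i ∈ S, CutoffBounded d r C (p i)) :
    CutoffBounded d r (C ^ S.card) (fun k => ∀ i ∈ S, p i k) := by
  induction S using Finset.induction_on with
  | empty =>
    intro E F c hF
    obtain rfl : F = E := by ext k; simp [hF]
    simp
  | insert i S hi ih =>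
    have h := (ih fun i' hi' => hp i' (Finset.mem_insert_of_mem hi')).and
      (hp i (Finset.mem_insert_self i S)) hC
    rw [Finset.card_insert_of_notMem hi, pow_succ, mul_comm]
    convert h using 2
    simp [and_comm]

/-- Sharp cut-offs to dyadic bands in some coordinates and to an interval in the zeroth one. -/
lemma exists_cutoffBounded_block (d r : ℕ) (hr : 1 ≤ r) : ∃ C : ℝ, 0 < C ∧
    ∀ (s : Fin d → ℕ) (t : ℕ), CutoffBounded (d + 1) r C
      (fun k => (k 0).natAbs.size ≤ t ∧ ∀ i : Fin d, (k i.succ).natAbs.size = s i) := by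
  obtain ⟨C, hC, hCr⟩ := exists_cutoffBounded_halfspace r hr
  set C₁ := 2 ^ (2 * r) * (1 + C) with hC₁
  have hC₁0 : 0 < C₁ := by positivity
  set C₂ := C₁ * C with hC₂
  have hC₂0 : 0 < C₂ := by positivity
  have hsize : ∀ (j : Fin (d + 1)) (t : ℕ),
      CutoffBounded (d + 1) r C₂ (fun k => (k j).natAbs.size ≤ t) := by
    intro j t
    have h := (hCr (d + 1) j (-2 ^ t + 1)).and (hCr (d + 1) j (2 ^ t)).not hC₁0.le
    convert h using 2 with k
    rw [natAbs_size_le_iff, abs_lt, not_le]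
    constructor <;> rintro ⟨h1, h2⟩ <;> exact ⟨by linarith, h2⟩
  set C₃ := 2 ^ (2 * r) * (1 + C₂) with hC₃
  have hC₃0 : 0 < C₃ := by positivity
  set C₄ := max C₂ (C₃ * C₂) with hC₄
  have hmono : ∀ {C C' : ℝ} {p : (Fin (d + 1) → ℤ) → Prop}, C ≤ C' →
      CutoffBounded (d + 1) r C p → CutoffBounded (d + 1) r C' p := by
    intro C C' p hCC hp E F c hF
    refine (hp E F c hF).trans (mul_le_mul_of_nonneg_right hCC ?_)
    exact integral_nonneg fun x => by positivity
  have hband : ∀ (j : Fin (d + 1)) (t : ℕ),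
      CutoffBounded (d + 1) r C₄ (fun k => (k j).natAbs.size = t) := by
    intro j t
    rcases Nat.eq_zero_or_pos t with rfl | ht
    · refine hmono (le_max_left _ _) ?_
      simpa using hsize j 0
    · refine hmono (le_max_right _ _) ?_
      have h := (hsize j t).and (hsize j (t - 1)).not hC₃0.le
      convert h using 2 with k
      omega
  have hC₄0 : 0 < C₄ := lt_max_of_lt_left hC₂0
  refine ⟨C₄ ^ (Finset.univ : Finset (Fin d)).card * C₂, by positivity, fun s t => ?_⟩
  have h := (hsize 0 t).and (CutoffBounded.forall_mem hC₄0.le (Finset.univ : Finset (Fin d))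
    (p := fun i k => (k i.succ).natAbs.size = s i) fun i _ => hband i.succ (s i)) (by positivity)
  simpa using h

/-- The part of `f` where its modulus exceeds `τ`. -/
def cutAbove (τ : ℝ) (f : Torus d → ℂ) (x : Torus d) : ℂ := if τ < ‖f x‖ then f x else 0

/-- The part of `f` where its modulus is at most `τ`. -/
def cutBelow (τ : ℝ) (f : Torus d → ℂ) (x : Torus d) : ℂ := if τ < ‖f x‖ then 0 else f x

lemma cutAbove_add_cutBelow (τ : ℝ) (f : Torus d → ℂ) (x : Torus d) :
    cutAbove τ f x + cutBelow τ f x = f x := by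
  unfold cutAbove cutBelow; split_ifs <;> simp

lemma stronglyMeasurable_cutAbove {f : Torus d → ℂ} (hf : StronglyMeasurable f) (τ : ℝ) :
    StronglyMeasurable (cutAbove τ f) :=
  StronglyMeasurable.ite (measurableSet_lt measurable_const hf.norm.measurable) hf
    stronglyMeasurable_const

lemma stronglyMeasurable_cutBelow {f : Torus d → ℂ} (hf : StronglyMeasurable f) (τ : ℝ) :
    StronglyMeasurable (cutBelow τ f) :=
  StronglyMeasurable.ite (measurableSet_lt measurable_const hf.norm.measurable)
    stronglyMeasurable_const hf

lemma norm_cutBelow_le {τ : ℝ} (hτ : 0 ≤ τ) (f : Torus d → ℂ) (x : Torus d) :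
    ‖cutBelow τ f x‖ ≤ τ := by
  unfold cutBelow; split_ifs with h
  · simpa using hτ
  · exact not_lt.1 h

lemma norm_cutAbove_le (τ : ℝ) (f : Torus d → ℂ) (x : Torus d) :
    ‖cutAbove τ f x‖ ≤ ‖f x‖ := by
  unfold cutAbove; split_ifs with h <;> simp

lemma norm_cutBelow_le_norm (τ : ℝ) (f : Torus d → ℂ) (x : Torus d) :
    ‖cutBelow τ f x‖ ≤ ‖f x‖ := by
  unfold cutBelow; split_ifs with h <;> simp

lemma norm_cutAbove_sq_le {τ p : ℝ} (hτ : 0 < τ) (hp : 2 ≤ p) (f : Torus d → ℂ) (x : Torus d) :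
    ‖cutAbove τ f x‖ ^ 2 ≤ τ ^ (2 - p) * ‖f x‖ ^ p := by
  unfold cutAbove; split_ifs with h
  · have h0 : 0 < ‖f x‖ := hτ.trans h
    have h1 : ‖f x‖ ^ (2 - p) ≤ τ ^ (2 - p) :=
      Real.rpow_le_rpow_of_nonpos hτ h.le (by linarith)
    calc ‖f x‖ ^ 2 = ‖f x‖ ^ (2 - p) * ‖f x‖ ^ p := by
          rw [← Real.rpow_add h0, sub_add_cancel]; norm_num
      _ ≤ _ := by gcongr
  · rw [norm_zero, zero_pow two_ne_zero]; positivity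

lemma memLp_two_cutAbove {τ p : ℝ} (hτ : 0 < τ) (hp : 2 ≤ p) {f : Torus d → ℂ}
    (hf : StronglyMeasurable f) (hfp : Integrable fun x => ‖f x‖ ^ p) :
    MemLp (cutAbove τ f) 2 := by
  rw [memLp_two_iff_integrable_sq_norm (stronglyMeasurable_cutAbove hf τ).aestronglyMeasurable]
  refine (hfp.const_mul (τ ^ (2 - p))).mono'
    ((stronglyMeasurable_cutAbove hf τ).norm.pow 2).aestronglyMeasurable ?_
  refine Filter.Eventually.of_forall fun x => ?_
  rw [Real.norm_of_nonneg (by positivity)]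
  exact norm_cutAbove_sq_le hτ hp f x

lemma integral_norm_cutAbove_sq_le {τ p : ℝ} (hτ : 0 < τ) (hp : 2 ≤ p) {f : Torus d → ℂ}
    (hf : StronglyMeasurable f) (hfp : Integrable fun x => ‖f x‖ ^ p) :
    ∫ x, ‖cutAbove τ f x‖ ^ 2 ≤ τ ^ (2 - p) * ∫ x, ‖f x‖ ^ p := by
  rw [← integral_const_mul]
  exact integral_mono ((memLp_two_cutAbove hτ hp hf hfp).integrable_norm_pow (by norm_num))
    (hfp.const_mul _) (norm_cutAbove_sq_le hτ hp f)

lemma integrable_of_bounded_torus {f : Torus d → ℂ} (hf : StronglyMeasurable f) {B : ℝ}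
    (hB : ∀ x, ‖f x‖ ≤ B) : Integrable f :=
  memLp_one_iff_integrable.1
    (MemLp.of_bound hf.aestronglyMeasurable B (Filter.Eventually.of_forall hB))

/-- The Fourier multiplier with symbol `M` on the finite set of frequencies `E`. -/
def fourierMult (E : Finset (Fin d → ℤ)) (M : (Fin d → ℤ) → ℂ) (f : Torus d → ℂ) :
    Torus d → ℂ :=
  trigPoly E (fun k => M k * fCoeff f k)

lemma continuous_fourierMult (E : Finset (Fin d → ℤ)) (M : (Fin d → ℤ) → ℂ) (f : Torus d → ℂ) :
    Continuous (fourierMult E M f) :=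
  continuous_trigPoly _ _

lemma fourierMult_add (E : Finset (Fin d → ℤ)) (M : (Fin d → ℤ) → ℂ) {f g : Torus d → ℂ}
    (hf : Integrable f) (hg : Integrable g) (x : Torus d) :
    fourierMult E M (fun x => f x + g x) x = fourierMult E M f x + fourierMult E M g x := by
  unfold fourierMult
  rw [← trigPoly_add]
  simp only [fCoeff_add hf hg, mul_add]

/-- A finite family of multipliers that are uniformly bounded on `L_∞` and whose square function
is bounded. -/
structure MultFamily {ι : Type} (I : Finset ι) (E : ι → Finset (Fin d → ℤ))
    (M : ι → (Fin d → ℤ) → ℂ) (K A : ℝ) : Prop where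
  kernel_le : ∀ i ∈ I, ∫ x, ‖trigPoly (E i) (M i) x‖ ≤ torusVol d * K
  sum_sq_le : ∀ k, ∑ i ∈ I, ‖M i k‖ ^ 2 ≤ A

lemma MultFamily.sum_integral_sq_le {ι : Type} {I : Finset ι} {E : ι → Finset (Fin d → ℤ)}
    {M : ι → (Fin d → ℤ) → ℂ} {K A : ℝ} (h : MultFamily I E M K A) {f : Torus d → ℂ}
    (hf : MemLp f 2) :
    ∑ i ∈ I, ∫ x, ‖fourierMult (E i) (M i) f x‖ ^ 2 ≤ A * ∫ x, ‖f x‖ ^ 2 := by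
  have hA : 0 ≤ A := (Finset.sum_nonneg fun i _ => by positivity).trans (h.sum_sq_le 0)
  set U := I.biUnion E
  have hV := torusVol_pos (d := d)
  calc ∑ i ∈ I, ∫ x, ‖fourierMult (E i) (M i) f x‖ ^ 2
      ≤ ∑ i ∈ I, torusVol d * ∑ k ∈ U, ‖M i k‖ ^ 2 * ‖fCoeff f k‖ ^ 2 := by
        refine Finset.sum_le_sum fun i hi => ?_
        unfold fourierMult
        rw [integral_norm_sq_trigPoly]
        simp only [norm_mul, mul_pow]
        refine mul_le_mul_of_nonneg_left ?_ hV.le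
        exact Finset.sum_le_sum_of_subset_of_nonneg (Finset.subset_biUnion_of_mem E hi)
          fun _ _ _ => by positivity
    _ = torusVol d * ∑ k ∈ U, (∑ i ∈ I, ‖M i k‖ ^ 2) * ‖fCoeff f k‖ ^ 2 := by
        rw [← Finset.mul_sum, Finset.sum_comm]
        simp only [Finset.sum_mul]
    _ ≤ torusVol d * ∑ k ∈ U, A * ‖fCoeff f k‖ ^ 2 := by
        gcongr with k _
        exact h.sum_sq_le k
    _ = A * (torusVol d * ∑ k ∈ U, ‖fCoeff f k‖ ^ 2) := by rw [← Finset.mul_sum]; ring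
    _ ≤ _ := mul_le_mul_of_nonneg_left (bessel_torus hf U) hA

lemma le_or_pow_le_sum_dyadic {y L : ℝ} (hL : 0 ≤ L) (hy : 0 ≤ y) (hyL : y ≤ L) (q : ℕ)
    (hq : 2 ≤ q) (b : ℕ → ℝ) (hb : ∀ i, L / 2 ^ (i + 1) < y → y / 2 ≤ b i) (J : ℕ) :
    y ≤ L / 2 ^ J ∨ y ^ q ≤ ∑ i ∈ Finset.range J, (L / 2 ^ i) ^ (q - 2) * (4 * b i ^ 2) := by
  induction J with
  | zero => left; simpa using hyL
  | succ J ih =>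
    have hnn : ∀ i, 0 ≤ (L / 2 ^ i) ^ (q - 2) * (4 * b i ^ 2) := fun i => by positivity
    rw [Finset.sum_range_succ]
    rcases ih with h | h
    · by_cases h1 : y ≤ L / 2 ^ (J + 1)
      · exact Or.inl h1
      · right
        have h2 := hb J (not_le.1 h1)
        have h3 : y ^ q ≤ (L / 2 ^ J) ^ (q - 2) * (4 * b J ^ 2) := by
          calc y ^ q = y ^ (q - 2) * (4 * (y / 2) ^ 2) := by
                rw [show 4 * (y / 2) ^ 2 = y ^ 2 by ring, ← pow_add, Nat.sub_add_cancel hq]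
            _ ≤ _ := by gcongr
        have := Finset.sum_nonneg fun i (_ : i ∈ Finset.range J) => hnn i
        linarith
    · right
      have := hnn J
      linarith

lemma geom_sum_le_one_div {ρ : ℝ} (h0 : 0 ≤ ρ) (h1 : ρ < 1) (J : ℕ) :
    ∑ i ∈ Finset.range J, ρ ^ i ≤ 1 / (1 - ρ) := by
  rw [one_div, ← tsum_geometric_of_lt_one h0 h1]
  exact (summable_geometric_of_lt_one h0 h1).sum_le_tsum _ fun i _ => by positivity

/-- A Marcinkiewicz type inequality for bounded functions. -/
lemma exists_sum_integral_fourierMult_pow_le (p : ℝ) (hp : 2 ≤ p) (q : ℕ) (hq : p < q) (K A : ℝ)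
    (hK : 0 < K) (hA : 0 ≤ A) : ∃ C : ℝ, 0 < C ∧ ∀ (d : ℕ) (ι : Type) (I : Finset ι)
      (E : ι → Finset (Fin d → ℤ)) (M : ι → (Fin d → ℤ) → ℂ), MultFamily I E M K A →
      ∀ f : Torus d → ℂ, StronglyMeasurable f → ∀ τ : ℝ, 0 < τ → (∀ x, ‖f x‖ ≤ τ) →
        ∫ x, ‖f x‖ ^ p ≤ 1 →
        ∑ i ∈ I, ∫ x, ‖fourierMult (E i) (M i) f x‖ ^ q ≤ C * τ ^ (q - p) := by
  have hq2 : 2 ≤ q := by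
    have : (2 : ℝ) < q := lt_of_le_of_lt hp hq
    exact_mod_cast this.le
  set ρ : ℝ := (1 / 2) ^ (q - p) with hρ
  have hρ0 : 0 ≤ ρ := by positivity
  have hρ1 : ρ < 1 := Real.rpow_lt_one (by norm_num) (by norm_num) (by linarith)
  have hρ1' : 0 < 1 - ρ := by linarith
  refine ⟨(2 * K) ^ (q - 2) * (4 * A) * 2 ^ (p - 2) * (1 / (1 - ρ)) + 1, by positivity, ?_⟩
  intro d ι I E M hM f hf τ hτ hfτ hfp
  have hfpi : Integrable fun x => ‖f x‖ ^ p := by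
    refine Integrable.mono' (g := fun _ => τ ^ p) (integrable_const _)
      (hf.norm.measurable.pow_const p).aestronglyMeasurable (Filter.Eventually.of_forall fun x => ?_)
    rw [Real.norm_of_nonneg (by positivity)]
    exact Real.rpow_le_rpow (norm_nonneg _) (hfτ x) (by linarith)
  have hτi : ∀ i : ℕ, 0 < τ / 2 ^ i := fun i => by positivity
  have hae : ∀ i, Integrable (cutAbove (τ / 2 ^ i) f) := fun i =>
    integrable_of_bounded_torus (stronglyMeasurable_cutAbove hf _)
      fun x => (norm_cutAbove_le _ f x).trans (hfτ x)
  have hbe : ∀ i, Integrable (cutBelow (τ / 2 ^ i) f) := fun i =>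
    integrable_of_bounded_torus (stronglyMeasurable_cutBelow hf _)
      fun x => (norm_cutBelow_le_norm _ f x).trans (hfτ x)
  set T := fun i g x => fourierMult (E i) (M i) g x with hT
  have hTc : ∀ i g, Continuous (T i g) := fun i g => continuous_fourierMult _ _ _
  have hpt : ∀ s ∈ I, ∀ x, ∀ J, ‖T s f x‖ ^ q ≤ ∑ i ∈ Finset.range J,
      ((2 * K * τ) / 2 ^ i) ^ (q - 2) * (4 * ‖T s (cutAbove (τ / 2 ^ (i + 1)) f) x‖ ^ 2) +
        ((2 * K * τ) / 2 ^ J) ^ q := by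
    intro s hs x J
    have h0 : ‖T s f x‖ ≤ 2 * K * τ := by
      have := norm_multiplier_le (integrable_of_bounded_torus hf hfτ) hfτ (E s) (M s)
        (hM.kernel_le s hs) x
      have h1 : ‖T s f x‖ ≤ K * τ := this
      have : 0 < K * τ := by positivity
      linarith
    have hb : ∀ i : ℕ, 2 * K * τ / 2 ^ (i + 1) < ‖T s f x‖ →
        ‖T s f x‖ / 2 ≤ ‖T s (cutAbove (τ / 2 ^ (i + 1)) f) x‖ := by
      intro i hi
      have h1 : T s f x = T s (cutAbove (τ / 2 ^ (i + 1)) f) x +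
          T s (cutBelow (τ / 2 ^ (i + 1)) f) x := by
        simp only [hT]
        rw [← fourierMult_add _ _ (hae _) (hbe _)]
        simp only [cutAbove_add_cutBelow]
      have h2 : ‖T s (cutBelow (τ / 2 ^ (i + 1)) f) x‖ ≤ K * (τ / 2 ^ (i + 1)) :=
        norm_multiplier_le (hbe _) (norm_cutBelow_le (hτi _).le f) (E s) (M s)
          (hM.kernel_le s hs) x
      have h3 : ‖T s f x‖ ≤ ‖T s (cutAbove (τ / 2 ^ (i + 1)) f) x‖ + K * (τ / 2 ^ (i + 1)) := by
        rw [h1]; exact (norm_add_le _ _).trans (by gcongr)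
      have h4 : 2 * K * τ / 2 ^ (i + 1) = 2 * (K * (τ / 2 ^ (i + 1))) := by ring
      linarith
    rcases le_or_pow_le_sum_dyadic (by positivity) (norm_nonneg _) h0 q hq2 _ hb J with h | h
    · have h1 := pow_le_pow_left₀ (norm_nonneg _) h q
      refine h1.trans (le_add_of_nonneg_left ?_)
      exact Finset.sum_nonneg fun i _ => by positivity
    · refine h.trans (le_add_of_nonneg_right (by positivity))
  have hJ : ∀ J : ℕ, ∑ s ∈ I, ∫ x, ‖T s f x‖ ^ q ≤
      (2 * K) ^ (q - 2) * (4 * A) * 2 ^ (p - 2) * (1 / (1 - ρ)) * τ ^ (q - p) +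
        I.card * (torusVol d * ((2 * K * τ) / 2 ^ J) ^ q) := by
    intro J
    have h1 : ∀ s ∈ I, ∫ x, ‖T s f x‖ ^ q ≤ ∑ i ∈ Finset.range J,
        ((2 * K * τ) / 2 ^ i) ^ (q - 2) *
          (4 * ∫ x, ‖T s (cutAbove (τ / 2 ^ (i + 1)) f) x‖ ^ 2) +
        torusVol d * ((2 * K * τ) / 2 ^ J) ^ q := by
      intro s hs
      have hc1 := hTc s f
      have hinte : ∀ i ∈ Finset.range J, Integrable (fun x => ((2 * K * τ) / 2 ^ i) ^ (q - 2) *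
          (4 * ‖T s (cutAbove (τ / 2 ^ (i + 1)) f) x‖ ^ 2)) := by
        intro i _
        have := hTc s (cutAbove (τ / 2 ^ (i + 1)) f)
        exact integrable_of_continuous_torus (by fun_prop)
      calc _ ≤ ∫ x, (∑ i ∈ Finset.range J, ((2 * K * τ) / 2 ^ i) ^ (q - 2) *
              (4 * ‖T s (cutAbove (τ / 2 ^ (i + 1)) f) x‖ ^ 2) + ((2 * K * τ) / 2 ^ J) ^ q) :=
            integral_mono (integrable_of_continuous_torus (by fun_prop))
              ((integrable_finsetSum _ hinte).add (integrable_const _)) fun x => hpt s hs x J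
        _ = _ := by
            rw [integral_add (integrable_finsetSum _ hinte) (integrable_const _),
              integral_finsetSum _ hinte, integral_const, torus_volume_real_univ, smul_eq_mul]
            simp only [integral_const_mul]
    refine (Finset.sum_le_sum h1).trans ?_
    rw [Finset.sum_add_distrib, Finset.sum_const, nsmul_eq_mul, Finset.sum_comm]
    gcongr
    have h2 : ∀ i ∈ Finset.range J, ∑ s ∈ I, ((2 * K * τ) / 2 ^ i) ^ (q - 2) *
          (4 * ∫ x, ‖T s (cutAbove (τ / 2 ^ (i + 1)) f) x‖ ^ 2) ≤
        (2 * K) ^ (q - 2) * (4 * A) * 2 ^ (p - 2) * τ ^ (q - p) * ρ ^ i := by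
      intro i _
      rw [← Finset.mul_sum, ← Finset.mul_sum]
      have h3 := hM.sum_integral_sq_le (memLp_two_cutAbove (hτi (i + 1)) hp hf hfpi)
      have h4 := integral_norm_cutAbove_sq_le (hτi (i + 1)) hp hf hfpi
      have h5 : (τ / 2 ^ (i + 1)) ^ (2 - p) * ∫ x, ‖f x‖ ^ p ≤ (τ / 2 ^ (i + 1)) ^ (2 - p) :=
        mul_le_of_le_one_right (by positivity) hfp
      have h6 : (τ / 2 ^ (i + 1)) ^ (2 - p) = (τ / 2 ^ i) ^ (2 - p) * 2 ^ (p - 2) := by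
        rw [pow_succ, ← div_div, Real.div_rpow (hτi i).le (by norm_num), div_eq_mul_inv,
          ← Real.rpow_neg (by norm_num), neg_sub]
      have h7 : (τ / 2 ^ i) ^ (q - 2) * (τ / 2 ^ i) ^ (2 - p) = τ ^ (q - p) * ρ ^ i := by
        rw [← Real.rpow_natCast (_ / _), ← Real.rpow_add (hτi i), Nat.cast_sub hq2]
        have : ((q : ℝ) - (2 : ℕ) + (2 - p)) = q - p := by push_cast; ring
        rw [this, div_eq_mul_one_div, Real.mul_rpow hτ.le (by positivity), hρ,
          Real.rpow_pow_comm (by norm_num), one_div_pow]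
      calc _ ≤ ((2 * K * τ) / 2 ^ i) ^ (q - 2) *
              (4 * (A * ((τ / 2 ^ i) ^ (2 - p) * 2 ^ (p - 2)))) := by
            gcongr
            refine h3.trans ?_
            gcongr
            linarith
        _ = (2 * K) ^ (q - 2) * (4 * A) * 2 ^ (p - 2) *
              ((τ / 2 ^ i) ^ (q - 2) * (τ / 2 ^ i) ^ (2 - p)) := by
            rw [mul_div_assoc, mul_pow]; ring
        _ = _ := by rw [h7]; ring
    refine (Finset.sum_le_sum h2).trans ?_
    rw [← Finset.mul_sum]
    have := geom_sum_le_one_div hρ0 hρ1 J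
    calc _ ≤ (2 * K) ^ (q - 2) * (4 * A) * 2 ^ (p - 2) * τ ^ (q - p) * (1 / (1 - ρ)) := by gcongr
      _ = _ := by ring
  have hlim : Filter.Tendsto (fun J : ℕ =>
      (2 * K) ^ (q - 2) * (4 * A) * 2 ^ (p - 2) * (1 / (1 - ρ)) * τ ^ (q - p) +
        I.card * (torusVol d * ((2 * K * τ) / 2 ^ J) ^ q)) Filter.atTop
      (nhds ((2 * K) ^ (q - 2) * (4 * A) * 2 ^ (p - 2) * (1 / (1 - ρ)) * τ ^ (q - p))) := by
    have h1 : Filter.Tendsto (fun J : ℕ => (2 * K * τ) / 2 ^ J) Filter.atTop (nhds (0 : ℝ)) := by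
      have := (tendsto_pow_atTop_nhds_zero_of_lt_one (r := (1 / 2 : ℝ)) (by norm_num)
        (by norm_num)).const_mul (2 * K * τ)
      simpa [div_eq_mul_inv] using this
    have h2 := ((h1.pow q).const_mul (torusVol d)).const_mul (I.card : ℝ)
    rw [zero_pow (by omega), mul_zero, mul_zero] at h2
    simpa using h2.const_add
      ((2 * K) ^ (q - 2) * (4 * A) * 2 ^ (p - 2) * (1 / (1 - ρ)) * τ ^ (q - p))
  refine (ge_of_tendsto' hlim hJ).trans ?_
  have : 0 < τ ^ (q - p) := by positivity
  nlinarith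

/-- The exponents of the dyadic box attached to `s`: the zeroth coordinate receives what `s`
leaves of `n`. -/
def blockSize (n : ℕ) (s : Fin d → ℕ) : Fin (d + 1) → ℕ := Fin.cons (n - ∑ i, s i) s

/-- A box of frequencies containing the support of the smooth multiplier of the block `s`. -/
def blockBox (n : ℕ) (s : Fin d → ℕ) : Finset (Fin (d + 1) → ℤ) :=
  Fintype.piFinset fun j =>
    Finset.Ioo (-2 ^ (blockSize n s j + 1) : ℤ) (2 ^ (blockSize n s j + 1))

/-- The smooth multiplier of the block `s`, one coordinate at a time. -/
def blockFactor (n : ℕ) (s : Fin d → ℕ) : Fin (d + 1) → ℤ → ℝ :=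
  Fin.cons (vpMult (n - ∑ i, s i)) fun i => bandMult (s i)

/-- The smooth multiplier of the block `s`. -/
def blockMult (n : ℕ) (s : Fin d → ℕ) (k : Fin (d + 1) → ℤ) : ℂ :=
  ((∏ j, blockFactor n s j (k j) : ℝ) : ℂ)

/-- The union of those dyadic blocks in `Q_n` whose last coordinates are given by `s`. -/
def block (n : ℕ) (s : Fin d → ℕ) : Finset (Fin (d + 1) → ℤ) :=
  (blockBox n s).filter fun k =>
    (k 0).natAbs.size ≤ n - ∑ i, s i ∧ ∀ i : Fin d, (k i.succ).natAbs.size = s i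

/-- The indices of the blocks that make up `Q_n`. -/
def blockIdx (d n : ℕ) : Finset (Fin d → ℕ) :=
  (Fintype.piFinset fun _ => Finset.range (n + 1)).filter fun s => ∑ i, s i ≤ n

lemma mem_blockIdx {n : ℕ} {s : Fin d → ℕ} : s ∈ blockIdx d n ↔ ∑ i, s i ≤ n := by
  unfold blockIdx
  rw [Finset.mem_filter, Fintype.mem_piFinset]
  refine ⟨fun h => h.2, fun h => ⟨fun i => ?_, h⟩⟩
  have := Finset.single_le_sum (f := s) (fun _ _ => Nat.zero_le _) (Finset.mem_univ i)
  rw [Finset.mem_range]; omega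

lemma card_blockIdx_le (d n : ℕ) : (blockIdx d n).card ≤ (n + 1) ^ d := by
  refine (Finset.card_filter_le _ _).trans ?_
  simp [Fintype.card_piFinset]

lemma sum_blockSize {n : ℕ} {s : Fin d → ℕ} (hs : s ∈ blockIdx d n) :
    ∑ j, blockSize n s j = n := by
  rw [Fin.sum_univ_succ]
  have := mem_blockIdx.1 hs
  simp only [blockSize, Fin.cons_zero, Fin.cons_succ]
  omega

lemma card_blockBox_le {n : ℕ} {s : Fin d → ℕ} (hs : s ∈ blockIdx d n) :
    ((blockBox n s).card : ℝ) ≤ 4 ^ (d + 1) * 2 ^ n := by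
  unfold blockBox
  rw [Fintype.card_piFinset, Nat.cast_prod]
  have h : ∀ j ∈ (Finset.univ : Finset (Fin (d + 1))),
      ((Finset.Ioo (-2 ^ (blockSize n s j + 1) : ℤ) (2 ^ (blockSize n s j + 1))).card : ℝ) ≤
        4 * 2 ^ blockSize n s j := by
    intro j _
    rw [Int.card_Ioo]
    have h1 : ((2 ^ (blockSize n s j + 1) - -2 ^ (blockSize n s j + 1) - 1 : ℤ).toNat : ℤ) ≤
        4 * 2 ^ blockSize n s j := by
      have h2 : (1 : ℤ) ≤ 2 ^ blockSize n s j := one_le_pow₀ (by norm_num)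
      rw [pow_succ, Int.toNat_of_nonneg (by linarith)]
      linarith
    exact_mod_cast h1
  refine (Finset.prod_le_prod (fun _ _ => by positivity) h).trans ?_
  rw [Finset.prod_mul_distrib, Finset.prod_const, Finset.card_univ, Fintype.card_fin,
    Finset.prod_pow_eq_pow_sum, sum_blockSize hs]

lemma abs_lt_of_mem_blockBox {n : ℕ} {s : Fin d → ℕ} (hs : s ∈ blockIdx d n)
    {k : Fin (d + 1) → ℤ} (hk : k ∈ blockBox n s) (j : Fin (d + 1)) : |k j| < 2 ^ (n + 1) := by
  unfold blockBox at hk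
  rw [Fintype.mem_piFinset] at hk
  have h1 := hk j
  rw [Finset.mem_Ioo, ← abs_lt] at h1
  refine h1.trans_le ?_
  have h2 := Finset.single_le_sum (f := blockSize n s) (fun _ _ => Nat.zero_le _)
    (Finset.mem_univ j)
  rw [sum_blockSize hs] at h2
  gcongr
  norm_num

lemma blockMult_eq_one {n : ℕ} {s : Fin d → ℕ} {k : Fin (d + 1) → ℤ} (hk : k ∈ block n s) :
    blockMult n s k = 1 := by
  have h := (Finset.mem_filter.1 hk).2
  unfold blockMult
  rw [Fin.prod_univ_succ]
  simp only [blockFactor, Fin.cons_zero, Fin.cons_succ]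
  rw [vpMult_eq_one (natAbs_size_le_iff.1 h.1), Finset.prod_eq_one fun i _ =>
    bandMult_eq_one (h.2 i)]
  simp

lemma integral_norm_blockMult_le (n : ℕ) (s : Fin d → ℕ) :
    ∫ x, ‖trigPoly (blockBox n s) (blockMult n s) x‖ ≤ torusVol (d + 1) * 4 ^ (d + 1) := by
  refine integral_norm_tensor_trigPoly_le (d := d + 1) _ (blockFactor n s) (fun j => ?_)
  refine Fin.cases ?_ (fun i => ?_) j
  · refine (integral_norm_uniPoly_vpMult_le fun k hk => ?_).trans ?_
    · simp only [blockSize, Fin.cons_zero]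
      rw [Finset.mem_Ioo, ← abs_lt]
      exact hk
    · have := pi_pos
      linarith
  · refine integral_norm_uniPoly_bandMult_le fun k hk => ?_
    simp only [blockSize, Fin.cons_succ]
    rw [Finset.mem_Ioo, ← abs_lt]
    exact hk

lemma norm_blockMult_sq_le (n : ℕ) (s : Fin d → ℕ) (k : Fin (d + 1) → ℤ) :
    ‖blockMult n s k‖ ^ 2 ≤ ∏ i, bandMult (s i) (k i.succ) ^ 2 := by
  unfold blockMult
  rw [Complex.norm_real, Real.norm_eq_abs, sq_abs, Fin.prod_univ_succ, mul_pow,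
    Finset.prod_pow]
  simp only [blockFactor, Fin.cons_zero, Fin.cons_succ]
  have h := pow_le_one₀ (n := 2) (vpMult_nonneg (n - ∑ i, s i) (k 0)) (vpMult_le_one _ _)
  exact mul_le_of_le_one_left (sq_nonneg _) h

lemma sum_prod_bandMult_sq_le (N : ℕ) (l : Fin d → ℤ) :
    ∑ s ∈ Fintype.piFinset fun _ : Fin d => Finset.range N,
      ∏ i, bandMult (s i) (l i) ^ 2 ≤ 3 ^ d := by
  have h := Finset.prod_univ_sum (fun _ : Fin d => Finset.range N)
    fun i t => bandMult t (l i) ^ 2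
  rw [← h]
  calc _ ≤ ∏ _i : Fin d, (3 : ℝ) :=
        Finset.prod_le_prod (fun _ _ => Finset.sum_nonneg fun _ _ => sq_nonneg _)
          fun i _ => sum_bandMult_sq_le _ _
    _ = 3 ^ d := by rw [Finset.prod_const, Finset.card_univ, Fintype.card_fin]

lemma sum_norm_blockMult_sq_le (n : ℕ) (k : Fin (d + 1) → ℤ) :
    ∑ s ∈ blockIdx d n, ‖blockMult n s k‖ ^ 2 ≤ 3 ^ d := by
  refine (Finset.sum_le_sum fun s _ => norm_blockMult_sq_le n s k).trans ?_
  refine le_trans ?_ (sum_prod_bandMult_sq_le (n + 1) fun i => k i.succ)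
  refine Finset.sum_le_sum_of_subset_of_nonneg (Finset.filter_subset _ _) fun s _ _ => ?_
  exact Finset.prod_nonneg fun i _ => sq_nonneg _

lemma multFamily_block (d n : ℕ) :
    MultFamily (blockIdx d n) (blockBox n) (blockMult n) (4 ^ (d + 1)) (3 ^ d) :=
  ⟨fun s _ => integral_norm_blockMult_le n s, sum_norm_blockMult_sq_le n⟩

lemma inRho_iff {s : Fin d → ℕ} {k : Fin d → ℤ} :
    inRho s k ↔ ∀ j, (k j).natAbs.size = s j := by
  unfold inRho
  refine forall_congr' fun j => ?_
  rw [← natAbs_size_le_iff]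
  rcases hs : s j with _ | t
  · simp
  · have h1 : (2 ^ (t + 1) / 2 : ℤ) = 2 ^ t := by rw [pow_succ]; simp
    have h2 : (2 ^ t : ℤ) ≤ |k j| ↔ ¬ (k j).natAbs.size ≤ t := by
      rw [natAbs_size_le_iff, not_lt]
    rw [h1, h2]
    omega

lemma mem_hypCross {n : ℕ} {k : Fin d → ℤ} :
    k ∈ hypCross d n ↔ ∑ j, (k j).natAbs.size ≤ n := by
  unfold hypCross
  simp only [Finset.mem_filter, inRho_iff]
  constructor
  · rintro ⟨-, s, hs, hk⟩
    simpa only [hk] using hs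
  · intro h
    refine ⟨?_, _, h, fun _ => rfl⟩
    have h1 : ∀ j, |k j| < 2 ^ n := by
      intro j
      rw [← natAbs_size_le_iff]
      exact (Finset.single_le_sum (f := fun j => (k j).natAbs.size) (fun _ _ => Nat.zero_le _)
        (Finset.mem_univ j)).trans h
    rw [Finset.mem_Icc]
    exact ⟨fun j => (abs_lt.1 (h1 j)).1.le, fun j => (abs_lt.1 (h1 j)).2.le⟩

lemma mem_block {n : ℕ} {s : Fin d → ℕ} {k : Fin (d + 1) → ℤ} : k ∈ block n s ↔
    (k 0).natAbs.size ≤ n - ∑ i, s i ∧ ∀ i : Fin d, (k i.succ).natAbs.size = s i := by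
  unfold block blockBox
  rw [Finset.mem_filter, and_iff_right_iff_imp, Fintype.mem_piFinset]
  rintro ⟨h0, h1⟩ j
  rw [Finset.mem_Ioo, ← abs_lt, ← natAbs_size_le_iff]
  refine Fin.cases ?_ (fun i => ?_) j
  · simp only [blockSize, Fin.cons_zero]; omega
  · simp only [blockSize, Fin.cons_succ]; rw [h1 i]; omega

lemma hypCross_eq_biUnion_block (d n : ℕ) :
    hypCross (d + 1) n = (blockIdx d n).biUnion (block n) := by
  ext k
  rw [mem_hypCross, Finset.mem_biUnion, Fin.sum_univ_succ]
  simp only [mem_block, mem_blockIdx]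
  constructor
  · intro h
    refine ⟨fun i => (k i.succ).natAbs.size, ?_, ?_, fun _ => rfl⟩ <;> dsimp only <;> omega
  · rintro ⟨s, hs, h0, h1⟩
    simp only [h1]
    omega

lemma pairwiseDisjoint_block (d n : ℕ) :
    Set.PairwiseDisjoint (blockIdx d n : Set (Fin d → ℕ)) (block n) := by
  intro s _ t _ hst
  rw [Function.onFun, Finset.disjoint_left]
  intro k hk hk'
  apply hst
  funext i
  rw [← (mem_block.1 hk).2 i, (mem_block.1 hk').2 i]

lemma trigPoly_hypCross (d n : ℕ) (c : (Fin (d + 1) → ℤ) → ℂ) (x : Torus (d + 1)) :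
    trigPoly (hypCross (d + 1) n) c x = ∑ s ∈ blockIdx d n, trigPoly (block n s) c x := by
  unfold trigPoly
  rw [hypCross_eq_biUnion_block, Finset.sum_biUnion (pairwiseDisjoint_block d n)]

lemma trigPoly_congr {E : Finset (Fin d → ℤ)} {c c' : (Fin d → ℤ) → ℂ}
    (h : ∀ k ∈ E, c k = c' k) : trigPoly E c = trigPoly E c' := by
  funext x
  exact Finset.sum_congr rfl fun k hk => by rw [h k hk]

lemma trigPoly_eq_of_subset {E F : Finset (Fin d → ℤ)} (hFE : F ⊆ E) (c : (Fin d → ℤ) → ℂ) :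
    trigPoly E (fun k => if k ∈ F then c k else 0) = trigPoly F c := by
  funext x
  unfold trigPoly
  simp only [ite_mul, zero_mul]
  rw [← Finset.sum_filter, Finset.filter_mem_eq_inter, Finset.inter_eq_right.2 hFE]

lemma trigPoly_biUnion {ι : Type*} (I : Finset ι) (E : ι → Finset (Fin d → ℤ))
    (c : ι → (Fin d → ℤ) → ℂ) (x : Torus d) :
    trigPoly (I.biUnion E) (fun k => ∑ i ∈ I, if k ∈ E i then c i k else 0) x =
      ∑ i ∈ I, trigPoly (E i) (c i) x := by
  have h : ∀ i ∈ I, trigPoly (E i) (c i) x =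
      ∑ k ∈ I.biUnion E, (if k ∈ E i then c i k else 0) * trigChar k x := by
    intro i hi
    rw [← trigPoly_eq_of_subset (Finset.subset_biUnion_of_mem E hi) (c i)]
    rfl
  rw [Finset.sum_congr rfl h, Finset.sum_comm]
  simp only [trigPoly, Finset.sum_mul]

lemma sum_norm_biUnion_le {ι : Type*} (I : Finset ι) (E : ι → Finset (Fin d → ℤ))
    (c : ι → (Fin d → ℤ) → ℂ) :
    ∑ k ∈ I.biUnion E, ‖∑ i ∈ I, if k ∈ E i then c i k else 0‖ ≤
      ∑ i ∈ I, ∑ k ∈ E i, ‖c i k‖ := by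
  have h : ∀ i ∈ I, ∑ k ∈ E i, ‖c i k‖ = ∑ k ∈ I.biUnion E, ‖if k ∈ E i then c i k else 0‖ := by
    intro i hi
    simp only [apply_ite norm, norm_zero]
    rw [← Finset.sum_filter, Finset.filter_mem_eq_inter,
      Finset.inter_eq_right.2 (Finset.subset_biUnion_of_mem E hi)]
  rw [Finset.sum_congr rfl h, Finset.sum_comm]
  exact Finset.sum_le_sum fun k _ => norm_sum_le _ _

lemma sq_sum_sum_norm_add_le {ι : Type*} (I : Finset ι) (E : ι → Finset (Fin d → ℤ))
    (a b : ι → (Fin d → ℤ) → ℂ) {N A B : ℝ} (hN : ∀ i ∈ I, ((E i).card : ℝ) ≤ N)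
    (hN0 : 0 ≤ N) (hA : ∑ i ∈ I, ∑ k ∈ E i, ‖a i k‖ ^ 2 ≤ A)
    (hB : ∑ i ∈ I, ∑ k ∈ E i, ‖b i k‖ ^ 2 ≤ B) :
    (∑ i ∈ I, ∑ k ∈ E i, ‖a i k + b i k‖) ^ 2 ≤ I.card * N * (2 * (A + B)) := by
  have h1 : (∑ i ∈ I, ∑ k ∈ E i, ‖a i k + b i k‖) ^ 2 ≤
      (I.sigma E).card * ∑ i ∈ I, ∑ k ∈ E i, ‖a i k + b i k‖ ^ 2 := by
    rw [Finset.sum_sigma', Finset.sum_sigma']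
    exact sq_sum_le_card_mul_sum_sq
  have h2 : ∑ i ∈ I, ∑ k ∈ E i, ‖a i k + b i k‖ ^ 2 ≤ 2 * (A + B) := by
    calc _ ≤ ∑ i ∈ I, ∑ k ∈ E i, 2 * (‖a i k‖ ^ 2 + ‖b i k‖ ^ 2) := by
          refine Finset.sum_le_sum fun i _ => Finset.sum_le_sum fun k _ => ?_
          refine (pow_le_pow_left₀ (norm_nonneg _) (norm_add_le _ _) 2).trans ?_
          nlinarith [sq_nonneg (‖a i k‖ - ‖b i k‖)]
      _ = 2 * (∑ i ∈ I, ∑ k ∈ E i, ‖a i k‖ ^ 2 + ∑ i ∈ I, ∑ k ∈ E i, ‖b i k‖ ^ 2) := by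
          simp only [← Finset.mul_sum, Finset.sum_add_distrib]
      _ ≤ _ := by linarith
  have h3 : ((I.sigma E).card : ℝ) ≤ I.card * N := by
    rw [Finset.card_sigma, Nat.cast_sum, ← nsmul_eq_mul]
    exact Finset.sum_le_card_nsmul _ _ _ hN
  refine h1.trans (mul_le_mul h3 h2 ?_ (by positivity))
  exact Finset.sum_nonneg fun i _ => Finset.sum_nonneg fun k _ => by positivity

lemma block_subset_blockBox (n : ℕ) (s : Fin d → ℕ) : block n s ⊆ blockBox n s :=
  Finset.filter_subset _ _

lemma fourierMult_trigPoly_block (n : ℕ) (s : Fin d → ℕ) (c : (Fin (d + 1) → ℤ) → ℂ) :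
    fourierMult (blockBox n s) (blockMult n s) (trigPoly (block n s) c) =
      trigPoly (block n s) c := by
  unfold fourierMult
  rw [← trigPoly_eq_of_subset (block_subset_blockBox n s) c]
  refine trigPoly_congr fun k _ => ?_
  rw [trigPoly_eq_of_subset (block_subset_blockBox n s) c, fCoeff_trigPoly]
  split_ifs with h
  · rw [blockMult_eq_one h, one_mul]
  · rw [mul_zero]

/-- The hyperbolic cross projection of an `L_p` function is, up to a uniformly small error, a
trigonometric polynomial with controlled coefficients. -/
lemma exists_hypCross_decomposition (d : ℕ) (p : ℝ) (hp : 2 ≤ p) : ∃ C : ℝ, 0 < C ∧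
    ∀ (n : ℕ) (f : Torus (d + 1) → ℂ), StronglyMeasurable f →
      (Integrable fun x => ‖f x‖ ^ p) → ∫ x, ‖f x‖ ^ p ≤ 1 → ∀ τ : ℝ, 0 < τ →
      ∃ (E : Finset (Fin (d + 1) → ℤ)) (c : (Fin (d + 1) → ℤ) → ℂ),
        (∀ k ∈ E, ∀ j, |k j| < 2 ^ (n + 1)) ∧
        (∑ k ∈ E, ‖c k‖) ^ 2 ≤ C * ((n + 1 : ℝ) ^ d * 2 ^ n * τ ^ (2 - p)) ∧
        ∀ x, ‖trigPoly (hypCross (d + 1) n) (fCoeff f) x - trigPoly E c x‖ ≤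
          C * (τ * (n + 1 : ℝ) ^ d) := by
  obtain ⟨r, hr⟩ : ∃ r : ℕ, p < r := exists_nat_gt p
  have hr1 : 1 ≤ r := by
    have : (0 : ℝ) < r := by linarith
    exact_mod_cast this
  have hq : p < ((2 * r : ℕ) : ℝ) := by push_cast; linarith
  obtain ⟨CM, hCM, hM⟩ := exists_sum_integral_fourierMult_pow_le p hp (2 * r) hq (4 ^ (d + 1))
    (3 ^ d) (by positivity) (by positivity)
  obtain ⟨CR, hCR, hR⟩ := exists_cutoffBounded_block d r hr1
  set V := torusVol (d + 1) with hVdef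
  have hV : 0 < V := torusVol_pos
  refine ⟨4 ^ (d + 1) * (2 * (1 / V + 3 ^ d / V * (CR * CM))) + 4 ^ (d + 1), by positivity, ?_⟩
  intro n f hf hfi hf1 τ hτ
  set f₁ := cutAbove τ f with hf₁
  set f₂ := cutBelow τ f with hf₂
  have hf₁m : MemLp f₁ 2 := memLp_two_cutAbove hτ hp hf hfi
  have hf₁i : Integrable f₁ := hf₁m.integrable (by norm_num)
  have hf₂sm : StronglyMeasurable f₂ := stronglyMeasurable_cutBelow hf τ
  have hf₂b : ∀ x, ‖f₂ x‖ ≤ τ := norm_cutBelow_le hτ.le f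
  have hf₂i : Integrable f₂ := integrable_of_bounded_torus hf₂sm hf₂b
  have hfc : ∀ k, fCoeff f k = fCoeff f₁ k + fCoeff f₂ k := by
    intro k
    rw [← fCoeff_add hf₁i hf₂i]
    simp only [hf₁, hf₂, cutAbove_add_cutBelow]
  have hf₂p : ∫ x, ‖f₂ x‖ ^ p ≤ 1 := by
    refine le_trans ?_ hf1
    refine integral_mono_of_nonneg (Filter.Eventually.of_forall fun x => by positivity) hfi
      (Filter.Eventually.of_forall fun x => ?_)
    exact Real.rpow_le_rpow (norm_nonneg _) (norm_cutBelow_le_norm τ f x) (by linarith)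
  set I := blockIdx d n with hI
  have hfam := multFamily_block d n
  set h : (Fin d → ℕ) → Torus (d + 1) → ℂ := fun s => trigPoly (block n s) (fCoeff f₂) with hh
  have hhc : ∀ s, Continuous (h s) := fun s => continuous_trigPoly _ _
  have hhi : ∀ s, Integrable fun x => ‖h s x‖ ^ (((2 * r : ℕ) : ℝ)) := by
    intro s
    have := hhc s
    simp only [Real.rpow_natCast]
    exact integrable_of_continuous_torus (by fun_prop)
  have hhsm : ∀ s, StronglyMeasurable (h s) := fun s => (hhc s).stronglyMeasurable
  have hq2 : (2 : ℝ) ≤ ((2 * r : ℕ) : ℝ) := by linarith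
  set a : (Fin d → ℕ) → Torus (d + 1) → ℂ := fun s => cutAbove τ (h s) with ha
  set b : (Fin d → ℕ) → Torus (d + 1) → ℂ := fun s => cutBelow τ (h s) with hb
  have ham : ∀ s, MemLp (a s) 2 := fun s => memLp_two_cutAbove hτ hq2 (hhsm s) (hhi s)
  have hai : ∀ s, Integrable (a s) := fun s => (ham s).integrable (by norm_num)
  have hbb : ∀ s x, ‖b s x‖ ≤ τ := fun s => norm_cutBelow_le hτ.le (h s)
  have hbi : ∀ s, Integrable (b s) := fun s =>
    integrable_of_bounded_torus (stronglyMeasurable_cutBelow (hhsm s) τ) (hbb s)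
  set T := fun s g => fourierMult (blockBox (d := d) n s) (blockMult n s) g with hT
  have hdec : ∀ s x, h s x = T s (a s) x + T s (b s) x := by
    intro s x
    simp only [hT]
    rw [← fourierMult_add _ _ (hai s) (hbi s)]
    simp only [ha, hb, cutAbove_add_cutBelow]
    rw [hh, fourierMult_trigPoly_block]
  have hsum_h : ∑ s ∈ I, ∫ x, ‖h s x‖ ^ (2 * r) ≤ CR * (CM * τ ^ (((2 * r : ℕ) : ℝ) - p)) := by
    have h1 : ∀ s ∈ I, ∫ x, ‖h s x‖ ^ (2 * r) ≤ CR * ∫ x, ‖T s f₂ x‖ ^ (2 * r) := by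
      intro s _
      have := hR s (n - ∑ i, s i) (blockBox n s) (block n s)
        (fun k => blockMult n s k * fCoeff f₂ k) fun k => Finset.mem_filter
      rw [trigPoly_congr (E := block n s) (c' := fCoeff f₂) fun k hk => by
        rw [blockMult_eq_one hk, one_mul]] at this
      exact this
    refine (Finset.sum_le_sum h1).trans ?_
    rw [← Finset.mul_sum]
    exact mul_le_mul_of_nonneg_left
      (hM (d + 1) _ I _ _ hfam f₂ hf₂sm τ hτ hf₂b hf₂p) hCR.le
  have hsum_a : ∑ s ∈ I, ∫ x, ‖a s x‖ ^ 2 ≤ CR * CM * τ ^ (2 - p) := by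
    have h1 : ∀ s ∈ I, ∫ x, ‖a s x‖ ^ 2 ≤
        τ ^ (2 - ((2 * r : ℕ) : ℝ)) * ∫ x, ‖h s x‖ ^ (2 * r) := by
      intro s _
      have := integral_norm_cutAbove_sq_le hτ hq2 (hhsm s) (hhi s)
      simp only [Real.rpow_natCast (‖h s _‖)] at this
      exact this
    refine (Finset.sum_le_sum h1).trans ?_
    rw [← Finset.mul_sum]
    refine (mul_le_mul_of_nonneg_left hsum_h (by positivity)).trans (le_of_eq ?_)
    have h2 : τ ^ (2 - p) = τ ^ (2 - ((2 * r : ℕ) : ℝ)) * τ ^ (((2 * r : ℕ) : ℝ) - p) := by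
      rw [← Real.rpow_add hτ]; ring_nf
    rw [h2]; ring
  set c₁ : (Fin d → ℕ) → (Fin (d + 1) → ℤ) → ℂ :=
    fun s k => if k ∈ block n s then fCoeff f₁ k else 0 with hc₁
  set c₂ : (Fin d → ℕ) → (Fin (d + 1) → ℤ) → ℂ :=
    fun s k => blockMult n s k * fCoeff (a s) k with hc₂
  have hsum₁ : ∑ s ∈ I, ∑ k ∈ blockBox n s, ‖c₁ s k‖ ^ 2 ≤ 1 / V * τ ^ (2 - p) := by
    have h1 : ∀ s ∈ I, ∑ k ∈ blockBox n s, ‖c₁ s k‖ ^ 2 = ∑ k ∈ block n s, ‖fCoeff f₁ k‖ ^ 2 := by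
      intro s _
      simp only [hc₁, apply_ite norm, norm_zero, ite_pow, zero_pow two_ne_zero]
      rw [← Finset.sum_filter, Finset.filter_mem_eq_inter,
        Finset.inter_eq_right.2 (block_subset_blockBox n s)]
    rw [Finset.sum_congr rfl h1, ← Finset.sum_biUnion (pairwiseDisjoint_block d n)]
    have h2 := bessel_torus hf₁m (I.biUnion (block n))
    have h3 := integral_norm_cutAbove_sq_le hτ hp hf hfi
    have h4 : τ ^ (2 - p) * ∫ x, ‖f x‖ ^ p ≤ τ ^ (2 - p) :=
      mul_le_of_le_one_right (by positivity) hf1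
    rw [one_div, inv_mul_eq_div, le_div_iff₀' hV]
    linarith
  have hsum₂ : ∑ s ∈ I, ∑ k ∈ blockBox n s, ‖c₂ s k‖ ^ 2 ≤
      3 ^ d / V * (CR * CM) * τ ^ (2 - p) := by
    have h1 : ∀ s ∈ I, ∑ k ∈ blockBox n s, ‖c₂ s k‖ ^ 2 ≤ 3 ^ d / V * ∫ x, ‖a s x‖ ^ 2 := by
      intro s hs
      have h2 := integral_norm_sq_trigPoly (blockBox n s) (c₂ s)
      have h3 := hfam.sum_integral_sq_le (ham s)
      have h4 := Finset.single_le_sum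
        (f := fun i => ∫ x, ‖fourierMult (blockBox n i) (blockMult n i) (a s) x‖ ^ 2)
        (fun i _ => integral_nonneg fun x => by positivity) hs
      have h5 : ∫ x, ‖trigPoly (blockBox n s) (c₂ s) x‖ ^ 2 ≤ 3 ^ d * ∫ x, ‖a s x‖ ^ 2 :=
        h4.trans h3
      rw [div_mul_eq_mul_div, le_div_iff₀' hV]
      linarith
    refine (Finset.sum_le_sum h1).trans ?_
    rw [← Finset.mul_sum, mul_assoc]
    exact mul_le_mul_of_nonneg_left hsum_a (by positivity)
  refine ⟨I.biUnion (blockBox n),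
    fun k => ∑ s ∈ I, if k ∈ blockBox n s then c₁ s k + c₂ s k else 0, ?_, ?_, ?_⟩
  · intro k hk j
    obtain ⟨s, hs, hks⟩ := Finset.mem_biUnion.1 hk
    exact abs_lt_of_mem_blockBox hs hks j
  · have h1 := sum_norm_biUnion_le I (blockBox n) fun s k => c₁ s k + c₂ s k
    refine (pow_le_pow_left₀ (Finset.sum_nonneg fun _ _ => norm_nonneg _) h1 2).trans ?_
    refine (sq_sum_sum_norm_add_le I (blockBox n) c₁ c₂ (fun s hs => card_blockBox_le hs)
      (by positivity) hsum₁ hsum₂).trans ?_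
    have h2 : (I.card : ℝ) ≤ (n + 1 : ℝ) ^ d := by exact_mod_cast card_blockIdx_le d n
    calc _ ≤ (n + 1 : ℝ) ^ d * (4 ^ (d + 1) * 2 ^ n) *
            (2 * (1 / V * τ ^ (2 - p) + 3 ^ d / V * (CR * CM) * τ ^ (2 - p))) := by gcongr
      _ = 4 ^ (d + 1) * (2 * (1 / V + 3 ^ d / V * (CR * CM))) *
            ((n + 1 : ℝ) ^ d * 2 ^ n * τ ^ (2 - p)) := by ring
      _ ≤ _ := by
          gcongr
          exact le_add_of_nonneg_right (by positivity)
  · intro x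
    have h1 : trigPoly (hypCross (d + 1) n) (fCoeff f) x - trigPoly (I.biUnion (blockBox n))
        (fun k => ∑ s ∈ I, if k ∈ blockBox n s then c₁ s k + c₂ s k else 0) x =
        ∑ s ∈ I, T s (b s) x := by
      rw [trigPoly_biUnion, trigPoly_hypCross, ← Finset.sum_sub_distrib]
      refine Finset.sum_congr rfl fun s _ => ?_
      have h2 : trigPoly (block n s) (fCoeff f) x =
          trigPoly (block n s) (fCoeff f₁) x + h s x := by
        rw [← trigPoly_add]
        exact congrFun (trigPoly_congr fun k _ => hfc k) x
      rw [trigPoly_add, h2, hdec, hc₁, trigPoly_eq_of_subset (block_subset_blockBox n s)]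
      simp only [hT, fourierMult, hc₂]
      ring
    rw [h1]
    have h2 : ∀ s ∈ I, ‖T s (b s) x‖ ≤ 4 ^ (d + 1) * τ := fun s hs =>
      norm_multiplier_le (hbi s) (hbb s) _ _ (hfam.kernel_le s hs) x
    have h3 : (I.card : ℝ) ≤ (n + 1 : ℝ) ^ d := by exact_mod_cast card_blockIdx_le d n
    calc _ ≤ ∑ s ∈ I, ‖T s (b s) x‖ := norm_sum_le _ _
      _ ≤ I.card • (4 ^ (d + 1) * τ) := Finset.sum_le_card_nsmul _ _ _ h2
      _ ≤ (n + 1 : ℝ) ^ d * (4 ^ (d + 1) * τ) := by rw [nsmul_eq_mul]; gcongr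
      _ = 4 ^ (d + 1) * (τ * (n + 1 : ℝ) ^ d) := by ring
      _ ≤ _ := by
          gcongr
          exact le_add_of_nonneg_left (by positivity)

lemma exists_le_of_weighted_sum_le {κ : Type*} {E : Finset κ} {w F : κ → ℝ} {B : ℝ}
    (hw : ∀ k ∈ E, 0 ≤ w k) (hw1 : ∑ k ∈ E, w k = 1) (h : ∑ k ∈ E, w k * F k ≤ B) :
    ∃ k ∈ E, F k ≤ B := by
  by_contra! hlt
  have h1 : ∑ k ∈ E, w k * (F k - B) ≤ 0 := by
    simp only [mul_sub, Finset.sum_sub_distrib, ← Finset.sum_mul, hw1, one_mul]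
    linarith
  have h2 : ∀ k ∈ E, 0 ≤ w k * (F k - B) := fun k hk =>
    mul_nonneg (hw k hk) (sub_nonneg.2 (hlt k hk).le)
  have h3 := (Finset.sum_eq_zero_iff_of_nonneg h2).1 (le_antisymm h1 (Finset.sum_nonneg h2))
  have h4 : ∑ k ∈ E, w k = 0 := Finset.sum_eq_zero fun k hk => by
    rcases mul_eq_zero.1 (h3 k hk) with h | h
    · exact h
    · linarith [hlt k hk]
  linarith

/-- Derandomized exponential moment bound for an average of centred bounded vectors. -/
lemma exists_multiset_sum_exp_le {κ ι : Type*} [Fintype ι] {E : Finset κ} {w : κ → ℝ}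
    {Y : κ → ι → ℝ} (hw : ∀ k ∈ E, 0 ≤ w k) (hw1 : ∑ k ∈ E, w k = 1)
    (hY : ∀ k ∈ E, ∀ i, |Y k i| ≤ 2) (hY0 : ∀ i, ∑ k ∈ E, w k * Y k i = 0) {θ : ℝ}
    (hθ0 : 0 ≤ θ) (hθ : θ ≤ 1 / 2) (t : ℕ) :
    ∃ l : Multiset κ, l.card = t ∧ (∀ k ∈ l, k ∈ E) ∧
      ∑ i, exp (θ * (l.map fun k => Y k i).sum) ≤ Fintype.card ι * exp (4 * θ ^ 2 * t) := by
  induction t with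
  | zero => exact ⟨0, rfl, by simp, by simp⟩
  | succ t ih =>
    obtain ⟨l, hl, hlE, hs⟩ := ih
    have hexp : ∀ k ∈ E, ∀ i, exp (θ * Y k i) ≤ 1 + θ * Y k i + 4 * θ ^ 2 := by
      intro k hk i
      have h1 : |θ * Y k i| ≤ 1 := by
        rw [abs_mul, abs_of_nonneg hθ0]
        nlinarith [hY k hk i, abs_nonneg (Y k i)]
      have h2 := (abs_le.1 (Real.abs_exp_sub_one_sub_id_le h1)).2
      have h3 : (θ * Y k i) ^ 2 ≤ 4 * θ ^ 2 := by
        have h4 : Y k i ^ 2 ≤ 2 ^ 2 := by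
          rw [← sq_abs]; exact pow_le_pow_left₀ (abs_nonneg _) (hY k hk i) 2
        rw [mul_pow]; nlinarith [sq_nonneg θ]
      linarith
    have havg : ∑ k ∈ E, w k * ∑ i, exp (θ * (((k ::ₘ l).map fun k => Y k i).sum)) ≤
        Fintype.card ι * exp (4 * θ ^ 2 * (t + 1 : ℕ)) := by
      calc ∑ k ∈ E, w k * ∑ i, exp (θ * (((k ::ₘ l).map fun k => Y k i).sum))
          = ∑ i, exp (θ * (l.map fun k => Y k i).sum) * ∑ k ∈ E, w k * exp (θ * Y k i) := by
            simp only [Finset.mul_sum]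
            rw [Finset.sum_comm]
            refine Finset.sum_congr rfl fun i _ => Finset.sum_congr rfl fun k _ => ?_
            rw [Multiset.map_cons, Multiset.sum_cons, mul_add, exp_add]
            ring
        _ ≤ ∑ i, exp (θ * (l.map fun k => Y k i).sum) * exp (4 * θ ^ 2) := by
            refine Finset.sum_le_sum fun i _ => mul_le_mul_of_nonneg_left ?_ (exp_pos _).le
            calc ∑ k ∈ E, w k * exp (θ * Y k i)
                ≤ ∑ k ∈ E, w k * (1 + θ * Y k i + 4 * θ ^ 2) :=
                  Finset.sum_le_sum fun k hk => mul_le_mul_of_nonneg_left (hexp k hk i) (hw k hk)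
              _ = (∑ k ∈ E, w k) * (1 + 4 * θ ^ 2) + θ * ∑ k ∈ E, w k * Y k i := by
                  rw [Finset.sum_mul, Finset.mul_sum, ← Finset.sum_add_distrib]
                  exact Finset.sum_congr rfl fun k _ => by ring
              _ = 4 * θ ^ 2 + 1 := by rw [hw1, hY0]; ring
              _ ≤ exp (4 * θ ^ 2) := add_one_le_exp _
        _ ≤ (Fintype.card ι * exp (4 * θ ^ 2 * t)) * exp (4 * θ ^ 2) := by
            rw [← Finset.sum_mul]
            exact mul_le_mul_of_nonneg_right hs (exp_pos _).le
        _ = _ := by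
            rw [mul_assoc, ← exp_add]
            push_cast
            ring_nf
    obtain ⟨k, hkE, hk⟩ := exists_le_of_weighted_sum_le hw hw1 havg
    refine ⟨k ::ₘ l, by rw [Multiset.card_cons, hl], ?_, hk⟩
    intro k' hk'
    rcases Multiset.mem_cons.1 hk' with rfl | h
    exacts [hkE, hlE _ h]

lemma exists_multiset_sum_le {κ ι : Type*} [Fintype ι] {E : Finset κ} {w : κ → ℝ}
    {Y : κ → ι → ℝ} (hw : ∀ k ∈ E, 0 ≤ w k) (hw1 : ∑ k ∈ E, w k = 1)
    (hY : ∀ k ∈ E, ∀ i, |Y k i| ≤ 2) (hY0 : ∀ i, ∑ k ∈ E, w k * Y k i = 0) {L : ℝ} (hL : 0 < L)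
    (hι : (Fintype.card ι : ℝ) ≤ exp L) {t : ℕ} (ht : L ≤ t) :
    ∃ l : Multiset κ, l.card = t ∧ (∀ k ∈ l, k ∈ E) ∧
      ∀ i, (l.map fun k => Y k i).sum ≤ 4 * √(L / t) * t := by
  have ht0 : (0 : ℝ) < t := hL.trans_le ht
  set σ := √(L / t) with hσ
  have hσ0 : 0 < σ := Real.sqrt_pos.2 (by positivity)
  have hσ1 : σ ≤ 1 := by
    rw [hσ, Real.sqrt_le_one, div_le_one ht0]; exact ht
  have hσ2 : σ ^ 2 * t = L := by
    rw [hσ, Real.sq_sqrt (by positivity)]; field_simp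
  obtain ⟨l, hl, hlE, hs⟩ := exists_multiset_sum_exp_le hw hw1 hY hY0 (θ := σ / 2) (by positivity)
    (by linarith) t
  refine ⟨l, hl, hlE, fun i => ?_⟩
  have h1 : exp (σ / 2 * (l.map fun k => Y k i).sum) ≤ exp (2 * L) := by
    refine (Finset.single_le_sum (f := fun i => exp (σ / 2 * (l.map fun k => Y k i).sum))
      (fun _ _ => (exp_pos _).le) (Finset.mem_univ i)).trans (hs.trans ?_)
    have h2 : 4 * (σ / 2) ^ 2 * t = L := by rw [← hσ2]; ring
    rw [h2, two_mul, exp_add]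
    exact mul_le_mul_of_nonneg_right hι (exp_pos _).le
  have h2 := exp_le_exp.1 h1
  have h3 : σ * (l.map fun k => Y k i).sum ≤ σ * (4 * σ * t) := by
    have : σ * (4 * σ * t) = 4 * L := by rw [← hσ2]; ring
    linarith
  exact le_of_mul_le_mul_left h3 hσ0

lemma trigChar_coe (k : Fin d → ℤ) (y : Fin d → ℝ) :
    trigChar k (fun j => (y j : AddCircle (2 * π))) =
      Complex.exp (Complex.I * ((∑ j, k j * y j : ℝ) : ℂ)) := by
  rw [trigChar_apply]
  push_cast
  rw [Finset.mul_sum, Complex.exp_sum]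
  refine Finset.prod_congr rfl fun j _ => ?_
  rw [fourier_coe_apply]
  congr 1
  have : (π : ℂ) ≠ 0 := by exact_mod_cast pi_ne_zero
  push_cast
  field_simp

lemma norm_trigPoly_sub_le {E : Finset (Fin d → ℤ)} {c : (Fin d → ℤ) → ℂ} {R δ : ℝ}
    (hR : ∀ k ∈ E, ∀ j, |(k j : ℝ)| ≤ R) {y z : Fin d → ℝ}
    (hyz : ∀ j, |y j - z j| ≤ δ) :
    ‖trigPoly E c (fun j => (y j : AddCircle (2 * π))) -
      trigPoly E c (fun j => (z j : AddCircle (2 * π)))‖ ≤ (∑ k ∈ E, ‖c k‖) * (d * (R * δ)) := by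
  unfold trigPoly
  rw [← Finset.sum_sub_distrib, Finset.sum_mul]
  refine (norm_sum_le _ _).trans (Finset.sum_le_sum fun k hk => ?_)
  rw [← mul_sub, norm_mul]
  refine mul_le_mul_of_nonneg_left ?_ (norm_nonneg _)
  have h1 : (fun j => (y j : AddCircle (2 * π))) =
      (fun j => ((y j - z j : ℝ) : AddCircle (2 * π))) +
        fun j => (z j : AddCircle (2 * π)) := by
    funext j
    rw [Pi.add_apply, ← AddCircle.coe_add, sub_add_cancel]
  rw [h1, trigChar_add_point, ← sub_one_mul, norm_mul, norm_trigChar, mul_one, trigChar_coe]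
  refine Real.norm_exp_I_mul_ofReal_sub_one_le.trans ?_
  rw [Real.norm_eq_abs]
  refine (Finset.abs_sum_le_sum_abs _ _).trans ?_
  have h2 : ∀ j ∈ (Finset.univ : Finset (Fin d)), |(k j : ℝ) * (y j - z j)| ≤ R * δ := by
    intro j _
    rw [abs_mul]
    exact mul_le_mul (hR k hk j) (hyz j) (abs_nonneg _) ((abs_nonneg _).trans (hR k hk j))
  refine (Finset.sum_le_sum h2).trans ?_
  simp

lemma exists_grid_point {N : ℕ} (hN : 0 < N) (x : Torus d) :
    ∃ (a : Fin d → Fin N) (y : Fin d → ℝ), x = (fun j => (y j : AddCircle (2 * π))) ∧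
      ∀ j, |y j - 2 * π * (a j : ℕ) / N| ≤ 2 * π / N := by
  have key : ∀ θ : AddCircle (2 * π), ∃ (a : Fin N) (u : ℝ), θ = (u : AddCircle (2 * π)) ∧
      |u - 2 * π * (a : ℕ) / N| ≤ 2 * π / N := by
    intro θ
    have hN' : (0 : ℝ) < N := by exact_mod_cast hN
    have hp : 0 < 2 * π := by positivity
    set u : ℝ := (AddCircle.equivIco (2 * π) 0 θ : ℝ) with hu
    have hu2 : u ∈ Set.Ico (0 : ℝ) (0 + 2 * π) := (AddCircle.equivIco (2 * π) 0 θ).2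
    have hu0 : 0 ≤ u := hu2.1
    have hu1 : u < 2 * π := by simpa using hu2.2
    have hq : 0 ≤ u * N / (2 * π) := by positivity
    have hlt : ⌊u * N / (2 * π)⌋₊ < N := by
      rw [Nat.floor_lt hq, div_lt_iff₀ hp]
      nlinarith
    refine ⟨⟨_, hlt⟩, u, (AddCircle.coe_equivIco).symm, ?_⟩
    have h1 := Nat.floor_le hq
    have h2 := Nat.lt_floor_add_one (u * N / (2 * π))
    have h3 : u - 2 * π * (⌊u * N / (2 * π)⌋₊ : ℝ) / N =
        (u * N / (2 * π) - ⌊u * N / (2 * π)⌋₊) * (2 * π / N) := by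
      field_simp
    show |u - 2 * π * (⌊u * N / (2 * π)⌋₊ : ℝ) / N| ≤ _
    rw [h3, abs_mul, abs_of_pos (by positivity : 0 < 2 * π / N)]
    refine mul_le_of_le_one_left (by positivity) ?_
    rw [abs_le]; constructor <;> linarith
  choose a u h using fun j => key (x j)
  exact ⟨a, u, funext fun j => (h j).1, fun j => (h j).2⟩

lemma norm_le_of_forall_re_I_pow_mul_le {z : ℂ} {B : ℝ}
    (h : ∀ i : Fin 4, (Complex.I ^ (i : ℕ) * z).re ≤ B) : ‖z‖ ≤ 2 * B := by
  have h0 := h 0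
  have h1 := h 1
  have h2 := h 2
  have h3 := h 3
  simp [Complex.I_sq, Complex.I_pow_three] at h0 h1 h2 h3
  have := Complex.norm_le_abs_re_add_abs_im z
  have a : |z.re| ≤ B := abs_le.2 ⟨by linarith, h0⟩
  have b : |z.im| ≤ B := abs_le.2 ⟨by linarith, h3⟩
  linarith

lemma multiset_sum_map_re_mul_sub {κ : Type*} (l : Multiset κ) (ω q : ℂ) (v : κ → ℂ) :
    (l.map fun k => (ω * (v k - q)).re).sum = (ω * ((l.map v).sum - l.card * q)).re := by
  induction l using Multiset.induction_on with
  | empty => simp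
  | cons a l ih =>
    simp only [Multiset.map_cons, Multiset.sum_cons, Multiset.card_cons, ih, ← Complex.add_re]
    congr 1
    push_cast
    ring

lemma trigPoly_toFinset_count (l : Multiset (Fin d → ℤ)) (r : ℂ) (u : (Fin d → ℤ) → ℂ)
    (x : Torus d) :
    trigPoly l.toFinset (fun k => r * (u k * l.count k)) x =
      r * (l.map fun k => u k * trigChar k x).sum := by
  rw [Finset.sum_multiset_map_count, Finset.mul_sum]
  refine Finset.sum_congr rfl fun k _ => ?_
  rw [nsmul_eq_mul]
  ring

lemma sum_norm_toFinset_count_le (l : Multiset (Fin d → ℤ)) {r : ℝ} (hr : 0 ≤ r)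
    {u : (Fin d → ℤ) → ℂ} (hu : ∀ k, ‖u k‖ ≤ 1) :
    ∑ k ∈ l.toFinset, ‖(r : ℂ) * (u k * l.count k)‖ ≤ r * l.card := by
  have h : (l.card : ℝ) = ∑ k ∈ l.toFinset, (l.count k : ℝ) := by
    exact_mod_cast (Multiset.toFinset_sum_count_eq l).symm
  rw [h, Finset.mul_sum]
  refine Finset.sum_le_sum fun k _ => ?_
  rw [norm_mul, norm_mul, Complex.norm_real, Real.norm_of_nonneg hr, Complex.norm_natCast]
  refine mul_le_mul_of_nonneg_left (mul_le_of_le_one_left (by positivity) (hu k)) hr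

lemma exists_sparse_trigPoly_on_finite {α : Type*} [Fintype α] (X : α → Torus d)
    {E : Finset (Fin d → ℤ)} {c : (Fin d → ℤ) → ℂ} (hW : 0 < ∑ k ∈ E, ‖c k‖)
    {L : ℝ} (hL : 0 < L) (hα : 4 * (Fintype.card α : ℝ) ≤ exp L) {t : ℕ} (ht : L ≤ t) :
    ∃ Λ ⊆ E, Λ.card ≤ t ∧ ∃ c' : (Fin d → ℤ) → ℂ,
      ∑ k ∈ Λ, ‖c' k‖ ≤ ∑ k ∈ E, ‖c k‖ ∧
      ∀ a, ‖trigPoly E c (X a) - trigPoly Λ c' (X a)‖ ≤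
        8 * (∑ k ∈ E, ‖c k‖) * √(L / t) := by
  set W := ∑ k ∈ E, ‖c k‖ with hWdef
  have ht0 : (0 : ℝ) < t := hL.trans_le ht
  have hWC : (W : ℂ) ≠ 0 := by exact_mod_cast hW.ne'
  have htC : (t : ℂ) ≠ 0 := by exact_mod_cast ht0.ne'
  set u : (Fin d → ℤ) → ℂ := fun k => c k / (‖c k‖ : ℂ) with hu
  have hu1 : ∀ k, ‖u k‖ ≤ 1 := by
    intro k
    rw [hu]
    simp only [norm_div, Complex.norm_real, norm_norm]
    exact div_self_le_one _
  have huc : ∀ k, (‖c k‖ : ℂ) * u k = c k := by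
    intro k
    by_cases h : c k = 0
    · simp [hu, h]
    · have : (‖c k‖ : ℂ) ≠ 0 := by exact_mod_cast norm_ne_zero_iff.2 h
      rw [hu]; field_simp
  set w : (Fin d → ℤ) → ℝ := fun k => ‖c k‖ / W with hw
  have hw0 : ∀ k ∈ E, 0 ≤ w k := fun k _ => by positivity
  have hw1 : ∑ k ∈ E, w k = 1 := by
    rw [hw, ← Finset.sum_div, div_self hW.ne']
  set q : α → ℂ := fun a => trigPoly E c (X a) / W with hq
  have hq1 : ∀ a, ‖q a‖ ≤ 1 := by
    intro a
    rw [hq]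
    simp only [norm_div, Complex.norm_real, Real.norm_of_nonneg hW.le]
    rw [div_le_one hW]
    exact norm_trigPoly_le _ _ _
  set Y : (Fin d → ℤ) → α × Fin 4 → ℝ := fun k i =>
    (Complex.I ^ (i.2 : ℕ) * (u k * trigChar k (X i.1) - q i.1)).re with hYdef
  have hY : ∀ k ∈ E, ∀ i, |Y k i| ≤ 2 := by
    intro k _ i
    refine (Complex.abs_re_le_norm _).trans ?_
    rw [norm_mul, norm_pow, Complex.norm_I, one_pow, one_mul]
    refine (norm_sub_le _ _).trans ?_
    rw [norm_mul, norm_trigChar, mul_one]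
    linarith [hu1 k, hq1 i.1]
  have hY0 : ∀ i, ∑ k ∈ E, w k * Y k i = 0 := by
    intro i
    have h1 : ∀ k ∈ E, w k * Y k i = (Complex.I ^ (i.2 : ℕ) *
        ((c k * trigChar k (X i.1)) / W - (w k : ℂ) * q i.1)).re := by
      intro k _
      rw [← Complex.re_ofReal_mul]
      congr 1
      rw [← huc k, hw]
      push_cast
      field_simp
    rw [Finset.sum_congr rfl h1, ← Complex.re_sum, ← Finset.mul_sum, Finset.sum_sub_distrib,
      ← Finset.sum_mul, ← Finset.sum_div]
    have h2 : ∑ k ∈ E, (w k : ℂ) = 1 := by exact_mod_cast hw1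
    rw [h2, one_mul]
    show (_ * (trigPoly E c (X i.1) / W - q i.1)).re = 0
    simp [hq]
  have hcard : (Fintype.card (α × Fin 4) : ℝ) ≤ exp L := by
    rw [Fintype.card_prod, Fintype.card_fin]
    push_cast
    linarith
  obtain ⟨l, hl, hlE, hs⟩ := exists_multiset_sum_le hw0 hw1 hY hY0 hL hcard ht
  refine ⟨l.toFinset, fun k hk => hlE k (Multiset.mem_toFinset.1 hk),
    hl ▸ Multiset.toFinset_card_le l,
    fun k => ((W / t : ℝ) : ℂ) * (u k * l.count k), ?_, fun a => ?_⟩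
  · refine (sum_norm_toFinset_count_le l (by positivity) hu1).trans ?_
    rw [hl]
    exact (div_mul_cancel₀ _ ht0.ne').le
  · set Z : ℂ := (l.map fun k => u k * trigChar k (X a)).sum - t * q a with hZ
    have h1 : ‖Z‖ ≤ 2 * (4 * √(L / t) * t) := by
      refine norm_le_of_forall_re_I_pow_mul_le fun i => ?_
      have := hs (a, i)
      rw [hYdef] at this
      simp only at this
      rw [multiset_sum_map_re_mul_sub, hl] at this
      exact this
    have h2 : trigPoly E c (X a) -
        trigPoly l.toFinset (fun k => ((W / t : ℝ) : ℂ) * (u k * l.count k)) (X a) =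
        -(((W / t : ℝ) : ℂ) * Z) := by
      rw [trigPoly_toFinset_count, hZ, hq]
      push_cast
      field_simp
      ring
    rw [h2, norm_neg, norm_mul, Complex.norm_real, Real.norm_of_nonneg (by positivity)]
    calc W / t * ‖Z‖ ≤ W / t * (2 * (4 * √(L / t) * t)) := by gcongr
      _ = _ := by field_simp; ring

lemma exists_sparse_trigPoly_of_le {E : Finset (Fin d → ℤ)} {c : (Fin d → ℤ) → ℂ}
    (hW : 0 < ∑ k ∈ E, ‖c k‖) {R : ℝ} (hR : ∀ k ∈ E, ∀ j, |(k j : ℝ)| ≤ R)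
    {L : ℝ} (hL : 1 ≤ L) {t N : ℕ} (ht : L ≤ t) (hN0 : 0 < N) (hN : 4 * (N : ℝ) ^ d ≤ exp L)
    (hNR : 4 * π * (d * R * t) ≤ N) :
    ∃ Λ : Finset (Fin d → ℤ), Λ.card ≤ t ∧ ∃ c' : (Fin d → ℤ) → ℂ,
      ∀ x, ‖trigPoly E c x - trigPoly Λ c' x‖ ≤ 9 * (∑ k ∈ E, ‖c k‖) * √(L / t) := by
  have hL0 : 0 < L := by linarith
  have ht0 : (0 : ℝ) < t := hL0.trans_le ht
  have hN0' : (0 : ℝ) < N := by exact_mod_cast hN0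
  obtain ⟨Λ, hΛE, hΛ, c', hc', h⟩ := exists_sparse_trigPoly_on_finite
    (fun (a : Fin d → Fin N) j => ((2 * π * (a j : ℕ) / N : ℝ) : AddCircle (2 * π)))
    (c := c) hW hL0 (by simpa using hN) ht
  refine ⟨Λ, hΛ, c', fun x => ?_⟩
  obtain ⟨a, y, rfl, hy⟩ := exists_grid_point hN0 x
  have h1 := norm_trigPoly_sub_le (c := c) hR hy
  have h2 := norm_trigPoly_sub_le (c := c') (fun k hk => hR k (hΛE hk)) hy
  have h3 := h a
  set W := ∑ k ∈ E, ‖c k‖ with hWdef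
  set z : Torus d := fun j => ((2 * π * (a j : ℕ) / N : ℝ) : AddCircle (2 * π)) with hz
  set x : Torus d := fun j => (y j : AddCircle (2 * π)) with hx
  have hdR : 0 ≤ d * (R * (2 * π / N)) := by
    rcases Nat.eq_zero_or_pos d with h0 | h0
    · simp [h0]
    · obtain ⟨k, hk⟩ : E.Nonempty := by
        rw [Finset.nonempty_iff_ne_empty]; rintro rfl; simp [hWdef] at hW
      have := (abs_nonneg _).trans (hR k hk ⟨0, h0⟩)
      positivity
  have h4 : ‖trigPoly Λ c' x - trigPoly Λ c' z‖ ≤ W * (d * (R * (2 * π / N))) :=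
    h2.trans (mul_le_mul_of_nonneg_right hc' hdR)
  have h5 : d * (R * (2 * π / N)) * 2 ≤ 1 / t := by
    rw [le_div_iff₀ ht0]
    have : d * (R * (2 * π / N)) * 2 * t = 4 * π * (d * R * t) / N := by field_simp; ring
    rw [this, div_le_one hN0']
    exact hNR
  have ht1 : (1 : ℝ) ≤ t := hL.trans ht
  have h6 : 1 / (t : ℝ) ≤ √(L / t) := by
    refine Real.le_sqrt_of_sq_le ?_
    rw [div_pow, one_pow, div_le_div_iff₀ (by positivity) ht0]
    nlinarith
  have h7 : W * (d * (R * (2 * π / N))) * 2 ≤ W * √(L / t) := by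
    rw [mul_assoc]; exact mul_le_mul_of_nonneg_left (h5.trans h6) hW.le
  have h8 : trigPoly E c x - trigPoly Λ c' x = (trigPoly E c x - trigPoly E c z) +
      (trigPoly E c z - trigPoly Λ c' z) - (trigPoly Λ c' x - trigPoly Λ c' z) := by ring
  rw [h8]
  refine (norm_sub_le _ _).trans ?_
  have := norm_add_le (trigPoly E c x - trigPoly E c z) (trigPoly E c z - trigPoly Λ c' z)
  linarith

/-- Sparse uniform approximation of a trigonometric polynomial with absolutely summable
coefficients. -/
lemma exists_sparse_trigPoly {E : Finset (Fin d → ℤ)} (c : (Fin d → ℤ) → ℂ)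
    {R : ℝ} (hR : ∀ k ∈ E, ∀ j, |(k j : ℝ)| ≤ R)
    {L : ℝ} (hL : 1 ≤ L) {m N : ℕ} (hm : 1 ≤ m) (hN0 : 0 < N) (hN : 4 * (N : ℝ) ^ d ≤ exp L)
    (hNR : 4 * π * (d * R * m) ≤ N) :
    ∃ Λ : Finset (Fin d → ℤ), Λ.card ≤ m - 1 ∧ ∃ c' : (Fin d → ℤ) → ℂ,
      ∀ x, ‖trigPoly E c x - trigPoly Λ c' x‖ ≤ 13 * (∑ k ∈ E, ‖c k‖) * √(L / m) := by
  have hW0 : 0 ≤ ∑ k ∈ E, ‖c k‖ := Finset.sum_nonneg fun _ _ => norm_nonneg _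
  have hm0 : (0 : ℝ) < m := by exact_mod_cast hm
  have hmt : ((m - 1 : ℕ) : ℝ) = m - 1 := by push_cast [hm]; ring
  by_cases hcase : 0 < ∑ k ∈ E, ‖c k‖ ∧ L ≤ ((m - 1 : ℕ) : ℝ)
  · obtain ⟨hW, ht⟩ := hcase
    have hNR' : 4 * π * (d * R * (m - 1 : ℕ)) ≤ N := by
      refine le_trans ?_ hNR
      rcases Nat.eq_zero_or_pos d with h0 | h0
      · simp [h0]
      · obtain ⟨k, hk⟩ : E.Nonempty := by
          rw [Finset.nonempty_iff_ne_empty]; rintro rfl; simp at hW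
        have := (abs_nonneg _).trans (hR k hk ⟨0, h0⟩)
        gcongr
        exact Nat.sub_le _ _
    obtain ⟨Λ, hΛ, c', h⟩ := exists_sparse_trigPoly_of_le hW hR hL ht hN0 hN hNR'
    refine ⟨Λ, hΛ, c', fun x => (h x).trans ?_⟩
    have h1 : √(L / (m - 1 : ℕ)) ≤ √2 * √(L / m) := by
      rw [← Real.sqrt_mul (by norm_num)]
      refine Real.sqrt_le_sqrt ?_
      have : (0 : ℝ) < (m - 1 : ℕ) := by linarith
      rw [← mul_div_assoc, div_le_div_iff₀ this hm0]
      rw [hmt] at ht ⊢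
      nlinarith
    have h2 : 9 * √2 ≤ 13 := by
      have : √2 ≤ 13 / 9 := by
        rw [Real.sqrt_le_left (by norm_num)]; norm_num
      linarith
    calc 9 * (∑ k ∈ E, ‖c k‖) * √(L / (m - 1 : ℕ))
        ≤ 9 * (∑ k ∈ E, ‖c k‖) * (√2 * √(L / m)) := by gcongr
      _ = 9 * √2 * ((∑ k ∈ E, ‖c k‖) * √(L / m)) := by ring
      _ ≤ 13 * ((∑ k ∈ E, ‖c k‖) * √(L / m)) := by gcongr
      _ = _ := by ring
  · refine ⟨∅, by simp, 0, fun x => ?_⟩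
    have h0 : trigPoly (∅ : Finset (Fin d → ℤ)) 0 x = 0 := by simp [trigPoly]
    rw [h0, sub_zero]
    refine (norm_trigPoly_le _ _ _).trans ?_
    rcases hW0.eq_or_lt with hW | hW
    · rw [← hW]; simp
    · have hlt : (m : ℝ) - 1 < L := by
        rw [← hmt]; by_contra! h; exact hcase ⟨hW, h⟩
      have h1 : 1 / 2 ≤ √(L / m) := by
        refine Real.le_sqrt_of_sq_le ?_
        rw [le_div_iff₀ hm0]
        linarith
      nlinarith

lemma card_hypCross_le (d n : ℕ) : (hypCross d n).card ≤ (2 ^ (n + 2)) ^ d := by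
  refine (Finset.card_filter_le _ _).trans ?_
  rw [Pi.card_Icc]
  simp only [Int.card_Icc, Finset.prod_const, Finset.card_univ, Fintype.card_fin]
  refine Nat.pow_le_pow_left ?_ d
  have h : (1 : ℤ) ≤ 2 ^ n := one_le_pow₀ (by norm_num)
  zify
  rw [Int.toNat_of_nonneg (by linarith), pow_add]
  linarith

lemma four_mul_pow_le_exp (D : ℕ) {n m : ℕ} (hn : 1 ≤ n) (hm : m ≤ (2 ^ (n + 2)) ^ D) :
    4 * ((16 * D * 2 ^ (n + 1) * m : ℕ) : ℝ) ^ D ≤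
      exp ((2 + D * (16 * D + 3 * (D + 1)) : ℝ) * n) := by
  have hn' : (1 : ℝ) ≤ n := by exact_mod_cast hn
  have h2 : (2 : ℝ) ≤ exp 1 := by linarith [add_one_le_exp (1 : ℝ)]
  have hpow : ∀ a : ℕ, (2 : ℝ) ^ a ≤ exp a := by
    intro a
    rw [← mul_one (a : ℝ), exp_nat_mul]
    exact pow_le_pow_left₀ (by norm_num) h2 a
  have hm' : (m : ℝ) ≤ 2 ^ ((n + 2) * D) := by rw [pow_mul]; exact_mod_cast hm
  have h16 : (16 * D : ℝ) ≤ exp (16 * D) := by linarith [add_one_le_exp (16 * D : ℝ)]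
  have hN : ((16 * D * 2 ^ (n + 1) * m : ℕ) : ℝ) ≤ exp ((16 * D + 3 * (D + 1) : ℝ) * n) := by
    push_cast
    calc (16 * D * 2 ^ (n + 1) * m : ℝ) ≤ exp (16 * D) * 2 ^ (n + 2) * 2 ^ ((n + 2) * D) := by
          gcongr <;> norm_num
      _ = exp (16 * D) * 2 ^ ((n + 2) * (D + 1)) := by rw [mul_assoc, ← pow_add]; ring_nf
      _ ≤ exp (16 * D) * exp ((n + 2) * (D + 1) : ℕ) := by gcongr; exact hpow _
      _ ≤ _ := by
          rw [← exp_add]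
          refine exp_le_exp.2 ?_
          push_cast
          nlinarith [(Nat.cast_nonneg D : (0 : ℝ) ≤ D)]
  calc 4 * ((16 * D * 2 ^ (n + 1) * m : ℕ) : ℝ) ^ D
      ≤ exp (2 * n) * exp ((16 * D + 3 * (D + 1) : ℝ) * n) ^ D := by
        gcongr
        calc (4 : ℝ) = 2 ^ 2 := by norm_num
          _ ≤ exp (2 : ℕ) := hpow 2
          _ ≤ exp (2 * n) := exp_le_exp.2 (by push_cast; linarith)
    _ = _ := by
        rw [← exp_nat_mul, ← exp_add]
        ring_nf

/-- Balancing the truncation error against the error of the sparse approximation. -/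
lemma rpow_balance {X N e p : ℝ} (hX : 0 < X) (hN : 0 < N) (hp : 0 < p) :
    X ^ (1 / p) * N ^ ((1 - e) / p) * N ^ e = X ^ (1 / p) * N ^ (e * (1 - 1 / p) + 1 / p) ∧
    X * (N ^ e * N) * (X ^ (1 / p) * N ^ ((1 - e) / p)) ^ (2 - p) =
      (X ^ (1 / p) * N ^ (e * (1 - 1 / p) + 1 / p)) ^ 2 := by
  constructor
  · rw [mul_assoc, ← rpow_add hN]
    congr 2
    field_simp
    ring
  · rw [← rpow_natCast, mul_rpow (by positivity) (by positivity),
      mul_rpow (by positivity) (by positivity), ← rpow_mul hX.le, ← rpow_mul hN.le,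
      ← rpow_mul hX.le, ← rpow_mul hN.le]
    have h1 : X * X ^ (1 / p * (2 - p)) = X ^ (1 / p * ((2 : ℕ) : ℝ)) := by
      nth_rewrite 1 [← rpow_one X]
      rw [← rpow_add hX]
      congr 1
      push_cast
      field_simp
      ring
    have h2 : N ^ e * N * N ^ ((1 - e) / p * (2 - p)) =
        N ^ ((e * (1 - 1 / p) + 1 / p) * ((2 : ℕ) : ℝ)) := by
      nth_rewrite 2 [← rpow_one N]
      rw [← rpow_add hN, ← rpow_add hN]
      congr 1
      push_cast
      field_simp
      ring
    rw [← h1, ← h2]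
    ring

lemma exists_sparse_hypCross_approx (d : ℕ) (p : ℝ) (hp : 2 ≤ p) :
    ∃ C : ℝ, 0 < C ∧ ∀ n : ℕ, 1 ≤ n → ∀ m : ℕ, 1 ≤ m → m ≤ (hypCross (d + 1) n).card →
      ∀ f : Torus (d + 1) → ℂ, StronglyMeasurable f → Integrable (fun x => ‖f x‖ ^ p) →
      ∫ x, ‖f x‖ ^ p ≤ 1 →
      ∃ Λ : Finset (Fin (d + 1) → ℤ), Λ.card ≤ m - 1 ∧ ∃ c : (Fin (d + 1) → ℤ) → ℂ,
        ∀ x, ‖trigPoly (hypCross (d + 1) n) (fCoeff f) x - trigPoly Λ c x‖ ≤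
          C * (((2 ^ n : ℝ) / m) ^ (1 / p) * (n : ℝ) ^ ((d : ℝ) * (1 - 1 / p) + 1 / p)) := by
  obtain ⟨C, hC, H⟩ := exists_hypCross_decomposition d p hp
  set D : ℕ := d + 1 with hD
  set A : ℝ := 2 + D * (16 * D + 3 * (D + 1)) with hA
  have hA1 : 1 ≤ A := by
    have : (0 : ℝ) ≤ D * (16 * D + 3 * (D + 1)) := by positivity
    linarith
  refine ⟨C * 2 ^ d + 13 * √(A * C * 2 ^ d), by positivity, ?_⟩
  intro n hn m hm hmc f hfm hfi hf1
  have hn' : (1 : ℝ) ≤ n := by exact_mod_cast hn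
  have hn0 : (0 : ℝ) < n := by linarith
  have hm0 : (0 : ℝ) < m := by exact_mod_cast hm
  set X : ℝ := 2 ^ n / m with hX
  have hX0 : 0 < X := by positivity
  obtain ⟨hb1, hb2⟩ := rpow_balance (e := (d : ℝ)) hX0 hn0 (by linarith : 0 < p)
  set τ : ℝ := X ^ (1 / p) * (n : ℝ) ^ ((1 - d : ℝ) / p) with hτ
  have hτ0 : 0 < τ := by positivity
  set B : ℝ := X ^ (1 / p) * (n : ℝ) ^ ((d : ℝ) * (1 - 1 / p) + 1 / p) with hB
  have hB0 : 0 < B := by positivity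
  rw [rpow_natCast] at hb1 hb2
  obtain ⟨E, c, hE, hc, herr⟩ := H n f hfm hfi hf1 τ hτ0
  have hR : ∀ k ∈ E, ∀ j, |(k j : ℝ)| ≤ 2 ^ (n + 1) := by
    intro k hk j
    exact_mod_cast (hE k hk j).le
  have hAn : 1 ≤ A * n := by nlinarith
  obtain ⟨Λ, hΛ, c', h⟩ := exists_sparse_trigPoly c hR hAn hm
    (N := 16 * D * 2 ^ (n + 1) * m) (by positivity)
    (four_mul_pow_le_exp D hn (hmc.trans (card_hypCross_le _ _))) (by
      push_cast
      have : 4 * π ≤ 16 := by linarith [pi_lt_four]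
      calc 4 * π * (D * 2 ^ (n + 1) * m : ℝ) ≤ 16 * (D * 2 ^ (n + 1) * m : ℝ) := by gcongr
        _ = _ := by ring)
  refine ⟨Λ, hΛ, c', fun x => ?_⟩
  have hn1 : (n + 1 : ℝ) ^ d ≤ 2 ^ d * n ^ d := by
    rw [← mul_pow]; exact pow_le_pow_left₀ (by positivity) (by linarith) d
  have h1 : C * (τ * (n + 1 : ℝ) ^ d) ≤ C * 2 ^ d * B := by
    calc C * (τ * (n + 1 : ℝ) ^ d) ≤ C * (τ * (2 ^ d * n ^ d)) := by gcongr
      _ = C * 2 ^ d * (τ * n ^ d) := by ring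
      _ = _ := by rw [hb1]
  set W := ∑ k ∈ E, ‖c k‖ with hW
  have hW0 : 0 ≤ W := Finset.sum_nonneg fun _ _ => norm_nonneg _
  have h2 : W * √(A * n / m) ≤ √(A * C * 2 ^ d) * B := by
    rw [← Real.sqrt_sq hW0, ← Real.sqrt_sq hB0.le, ← Real.sqrt_mul (sq_nonneg _),
      ← Real.sqrt_mul (by positivity)]
    refine Real.sqrt_le_sqrt ?_
    rw [← hb2]
    calc W ^ 2 * (A * n / m)
        ≤ C * ((n + 1 : ℝ) ^ d * 2 ^ n * τ ^ (2 - p)) * (A * n / m) := by gcongr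
      _ ≤ C * ((2 ^ d * n ^ d) * 2 ^ n * τ ^ (2 - p)) * (A * n / m) := by gcongr
      _ = _ := by rw [hX]; ring
  have h3 := norm_add_le (trigPoly (hypCross D n) (fCoeff f) x - trigPoly E c x)
    (trigPoly E c x - trigPoly Λ c' x)
  rw [sub_add_sub_cancel] at h3
  have h4 := herr x
  have h5 := h x
  nlinarith

lemma norm_toLinfty_sub_le {g h : C(Torus d, ℂ)} {B : ℝ} (hB : 0 ≤ B)
    (hgh : ∀ x, ‖g x - h x‖ ≤ B) : ‖toLinfty g - toLinfty h‖ ≤ B := by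
  unfold toLinfty
  rw [← map_sub]
  have := Lp.norm_le_of_ae_bound (f := ContinuousMap.toLp ∞ (volume : Measure (Torus d)) ℂ (g - h))
    hB (by
      filter_upwards [ContinuousMap.coeFn_toLp (p := ∞) (volume : Measure (Torus d)) (𝕜 := ℂ)
        (g - h)] with x hx
      rw [hx]
      exact hgh x)
  simpa using this

lemma sum_smul_trigChar_apply (E : Finset (Fin d → ℤ)) (c : (Fin d → ℤ) → ℂ) (x : Torus d) :
    (∑ k ∈ E, c k • trigChar k : C(Torus d, ℂ)) x = trigPoly E c x := by
  simp [trigPoly, ContinuousMap.coe_sum]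

lemma integral_norm_rpow_le_one {p : ℝ} (hp : 0 < p)
    (f : Lp ℂ (ENNReal.ofReal p) (volume : Measure (Torus d))) (hf : ‖f‖ ≤ 1) :
    Integrable (fun x => ‖f x‖ ^ p) ∧ ∫ x, ‖f x‖ ^ p ≤ 1 := by
  have hp0 : ENNReal.ofReal p ≠ 0 := by simpa using hp
  have hf' := Lp.memLp f
  have hi := hf'.integrable_norm_rpow hp0 ENNReal.ofReal_ne_top
  rw [ENNReal.toReal_ofReal hp.le] at hi
  refine ⟨hi, ?_⟩
  rw [Lp.norm_def, hf'.eLpNorm_eq_integral_rpow_norm hp0 ENNReal.ofReal_ne_top,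
    ENNReal.toReal_ofReal hp.le, ENNReal.toReal_ofReal (by positivity)] at hf
  have h0 : 0 ≤ ∫ x, ‖f x‖ ^ p := integral_nonneg fun x => by positivity
  by_contra! h
  exact absurd hf (not_le.2 (Real.one_lt_rpow h (by positivity)))

end

theorem stmt14 (d : ℕ) (hd : 1 ≤ d) (p : ℝ) (hp : 2 ≤ p) :
    ∃ C : ℝ, 0 < C ∧ ∀ n : ℕ, 1 ≤ n → ∀ m : ℕ, 1 ≤ m → m ≤ (hypCross d n).card →
      sigmaA (SE d (ENNReal.ofReal p) (hypCross d n)) (sparseTrig d) m ≤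
        C * ((2 ^ n : ℝ) / m) ^ (1 / p) *
          (n : ℝ) ^ ((d - 1 : ℝ) * (1 - 1 / p) + 1 / p) := by
  obtain ⟨d, rfl⟩ := Nat.exists_eq_add_of_le' hd
  obtain ⟨C, hC, H⟩ := exists_sparse_hypCross_approx d p hp
  refine ⟨C, hC, fun n hn m hm hmc => ?_⟩
  have hd' : ((d + 1 : ℕ) : ℝ) - 1 = d := by push_cast; ring
  rw [hd', mul_assoc]
  have hB : 0 ≤ C * (((2 ^ n : ℝ) / m) ^ (1 / p) *
      (n : ℝ) ^ ((d : ℝ) * (1 - 1 / p) + 1 / p)) := by positivity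
  refine Real.iSup_le (fun f => ?_) hB
  obtain ⟨hfi, hf1⟩ := integral_norm_rpow_le_one (by linarith) f.1 f.2
  obtain ⟨Λ, hΛ, c, h⟩ := H n hn m hm hmc f.1 (Lp.stronglyMeasurable _) hfi hf1
  refine (ciInf_le ⟨0, by rintro _ ⟨y, rfl⟩; exact norm_nonneg _⟩
    (⟨_, Λ, hΛ, c, rfl⟩ : sparseTrig (d + 1) (m - 1))).trans ?_
  refine norm_toLinfty_sub_le hB fun x => ?_
  rw [sum_smul_trigChar_apply, sum_smul_trigChar_apply]
  exact h x

end
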